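/- There exists a set F of permutations of ℕ which, viewed as a set of functions ℕ → ℕ, is a closed subset of Baire space, such that F freely generates a subgroup G of S∞ (i.e., G is a free group with basis F), G is a maximal cofinitary group, and G, viewed as a set of functions ℕ → ℕ, is an Fσ subset of Baire space. -/

import Mathlib

/-- A set `s` in a topological space is Fσ if it is a countable union of closed sets. -/
def IsFsigma {X : Type*} [TopologicalSpace X] (s : Set X) : Prop :=
  ∃ f : ℕ → Set X, (∀ n, IsClosed (f n)) ∧ s = ⋃ n, f n

/-- A subgroup of `S∞ = Equiv.Perm ℕ` is cofinitary if every non-identity element has only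
finitely many fixed points. -/
def IsCofinitary (G : Subgroup (Equiv.Perm ℕ)) : Prop :=
  ∀ g ∈ G, g ≠ 1 → {n : ℕ | g n = n}.Finite

/-- A cofinitary group is maximal if it is not strictly contained in any cofinitary group. -/
def IsMaximalCofinitary (G : Subgroup (Equiv.Perm ℕ)) : Prop :=
  IsCofinitary G ∧ ∀ H : Subgroup (Equiv.Perm ℕ), IsCofinitary H → G ≤ H → G = H

/-- A set `F` of permutations freely generates the subgroup it generates:
`⟨F⟩` is a free group with basis `F`. -/
def FreelyGenerates (F : Set (Equiv.Perm ℕ)) : Prop :=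
  ∃ φ : FreeGroup F ≃* (Subgroup.closure F),
    ∀ x : F, (φ (FreeGroup.of x) : Equiv.Perm ℕ) = (x : Equiv.Perm ℕ)

namespace MCG

/-- Nodes of the forest on which the group acts. -/
inductive T
  | src (n i : ℕ) : T
  | q (j i : ℕ) : T
  | child (p : T) (a : Bool) (s : List ℕ) (e : Bool) : T

def code : T → ℕ
  | T.src n i => 3 * Nat.pair n i + 1
  | T.q j i => 3 * Nat.pair j i + 2
  | T.child p a s e => 3 * Nat.pair (code p) (Encodable.encode (a, s, e)) + 3

theorem code_injective : Function.Injective code := by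
  intro p
  induction p with
  | src n i =>
    intro p' h
    cases p' with
    | src n' i' =>
      simp only [code] at h
      have h1 : Nat.pair n i = Nat.pair n' i' := by omega
      rw [Nat.pair_eq_pair] at h1
      rw [h1.1, h1.2]
    | q j i' => simp only [code] at h; omega
    | child p a s e => simp only [code] at h; omega
  | q n i =>
    intro p' h
    cases p' with
    | q n' i' =>
      simp only [code] at h
      have h1 : Nat.pair n i = Nat.pair n' i' := by omega
      rw [Nat.pair_eq_pair] at h1
      rw [h1.1, h1.2]
    | src j i' => simp only [code] at h; omega
    | child p a s e => simp only [code] at h; omega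
  | child p a s e ih =>
    intro p' h
    cases p' with
    | q n' i' => simp only [code] at h; omega
    | src j i' => simp only [code] at h; omega
    | child p' a' s' e' =>
      simp only [code] at h
      have h1 : Nat.pair (code p) (Encodable.encode (a, s, e))
        = Nat.pair (code p') (Encodable.encode (a', s', e')) := by omega
      rw [Nat.pair_eq_pair] at h1
      have h2 := ih h1.1
      have h3 := Encodable.encode_injective h1.2
      simp only [Prod.mk.injEq] at h3
      rw [h2, h3.1, h3.2.1, h3.2.2]

theorem code_child (p : T) (a s e) : code p < code (T.child p a s e) := by
  have := Nat.left_le_pair (code p) (Encodable.encode (a, s, e))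
  simp only [code]; omega

theorem lt_code_src (n i : ℕ) : n < code (T.src n i) := by
  have := Nat.left_le_pair n i
  simp only [code]; omega

theorem le_code_q (j i : ℕ) : i ≤ code (T.q j i) := by
  have := Nat.right_le_pair j i
  simp only [code]; omega

instance : Countable T := code_injective.countable

instance : Infinite T := Infinite.of_injective (fun n : ℕ => T.src n 0) (by
  intro a b h; simpa using h)

noncomputable def eqv : T ≃ ℕ := Classical.choice (nonempty_equiv_of_countable)

theorem finite_code_le (n : ℕ) : {p : T | code p ≤ n}.Finite :=
  Set.Finite.preimage (f := code) code_injective.injOn (Set.finite_Iic n)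

def root : T → T
  | T.src n i => T.src n i
  | T.q j i => T.q j i
  | T.child p _ _ _ => root p

def qidx : T → Option ℕ
  | T.src _ _ => none
  | T.q j _ => some j
  | T.child p _ _ _ => qidx p

theorem code_root_le (p : T) : code (root p) ≤ code p := by
  induction p with
  | src n i => exact le_rfl
  | q j i => exact le_rfl
  | child p a s e ih => exact ih.trans (code_child p a s e).le

theorem qidx_root (p : T) : qidx (root p) = qidx p := by
  induction p with
  | src n i => rfl
  | q j i => rfl
  | child p a s e ih => exact ih

/-- Prefix of a real. -/
def pre (x : ℕ → ℕ) (n : ℕ) : List ℕ := (List.range n).map x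

@[simp] theorem pre_length (x : ℕ → ℕ) (n : ℕ) : (pre x n).length = n := by simp [pre]

theorem pre_getElem (x : ℕ → ℕ) (n k : ℕ) (h : k < (pre x n).length) : (pre x n)[k] = x k := by
  simp [pre]

theorem pre_congr {x y : ℕ → ℕ} {n : ℕ} (h : ∀ k < n, x k = y k) : pre x n = pre y n := by
  apply List.map_congr_left
  intro a ha
  exact h a (List.mem_range.1 ha)

theorem pre_eq_iff {x y : ℕ → ℕ} {n : ℕ} : pre x n = pre y n ↔ ∀ k < n, x k = y k := by
  constructor
  · intro h k hk
    have h1 := pre_getElem x n k (by simpa using hk)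
    have h2 := pre_getElem y n k (by simpa using hk)
    rw [← h1, ← h2]
    simp only [h]
  · exact pre_congr

theorem pre_prefix {x : ℕ → ℕ} {m n : ℕ} (h : m ≤ n) : pre x m <+: pre x n := by
  refine ⟨(List.range' m (n - m)).map x, ?_⟩
  rw [pre, pre, ← List.map_append]
  congr 1
  rw [List.range_eq_range', List.range_eq_range']
  have := List.range'_append (s := 0) (m := m) (n := n - m) (step := 1)
  simp only [one_mul, zero_add] at this
  rw [this]
  congr 1
  omega

theorem eq_pre_of_prefix {x : ℕ → ℕ} {s : List ℕ} {n : ℕ} (h : s <+: pre x n) :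
    s = pre x s.length := by
  have hl : s.length ≤ n := by simpa using h.length_le
  have h2 : pre x s.length <+: pre x n := pre_prefix hl
  exact (List.prefix_of_prefix_length_le h h2 (by simp)).eq_of_length (by simp)

noncomputable def lam (x : ℕ → ℕ) (p : T) : List ℕ :=
  if (qidx p).isSome then pre x (code p)
  else (pre x (code p)).takeWhile (fun k => decide (k ≤ code p))

theorem lam_eq_pre (x : ℕ → ℕ) (p : T) : lam x p = pre x (lam x p).length := by
  apply eq_pre_of_prefix (n := code p)
  unfold lam
  split_ifs
  · exact List.prefix_rfl
  · exact List.takeWhile_prefix _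

theorem lam_congr {x y : ℕ → ℕ} {p : T} (h : ∀ k < code p, x k = y k) : lam x p = lam y p := by
  unfold lam
  rw [pre_congr h]

theorem lam_q {x : ℕ → ℕ} {p : T} (h : (qidx p).isSome) : lam x p = pre x (code p) := by
  unfold lam; rw [if_pos h]

theorem lam_long (x : ℕ → ℕ) (M : ℕ) : ∃ P, ∀ p, P ≤ code p → M ≤ (lam x p).length := by
  refine ⟨M + ∑ k ∈ Finset.range M, x k, fun p hp => ?_⟩
  have hM : M ≤ code p := by omega
  unfold lam
  split_ifs
  · simpa using hM
  · have h1 : pre x M <+: pre x (code p) := pre_prefix hM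
    obtain ⟨t, ht⟩ := h1
    rw [← ht, List.takeWhile_append_of_pos]
    · simp
    · intro a ha
      simp only [pre, List.mem_map, List.mem_range] at ha
      obtain ⟨k, hk, rfl⟩ := ha
      have : x k ≤ ∑ k ∈ Finset.range M, x k :=
        Finset.single_le_sum (f := x) (fun _ _ => Nat.zero_le _) (Finset.mem_range.2 hk)
      simp only [decide_eq_true_eq]
      omega

theorem lam_sep {x y : ℕ → ℕ} (h : x ≠ y) : ∃ P, ∀ p, P ≤ code p → lam x p ≠ lam y p := by
  obtain ⟨k, hk⟩ := Function.ne_iff.1 h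
  obtain ⟨P, hP⟩ := lam_long x (k + 1)
  refine ⟨P, fun p hp he => hk ?_⟩
  have h1 := lam_eq_pre x p
  have h2 := lam_eq_pre y p
  rw [he] at h1
  have h3 := pre_eq_iff.1 (h1.symm.trans h2)
  have h4 := hP p hp
  rw [he] at h4
  exact h3 k (by omega)

def LabSet (N : ℕ) : Set (List ℕ) := {s | s.length ≤ N ∧ ∀ a ∈ s, a ≤ N}

theorem LabSet_finite (N : ℕ) : (LabSet N).Finite := by
  refine ((List.finite_length_le (Fin (N + 1)) N).image (List.map Fin.val)).subset ?_
  rintro s ⟨h1, h2⟩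
  refine ⟨s.attach.map (fun a => ⟨a.1, Nat.lt_succ_of_le (h2 a.1 a.2)⟩), by simpa using h1, ?_⟩
  simp [List.map_map, Function.comp_def]

theorem lam_mem {x : ℕ → ℕ} {p : T} (h : qidx p = none) : lam x p ∈ LabSet (code p) := by
  unfold lam
  rw [h]
  simp only [Option.isSome_none, Bool.false_eq_true, if_false]
  constructor
  · exact (List.takeWhile_prefix _).length_le.trans (by simp)
  · intro a ha
    have := List.mem_takeWhile_imp ha
    simpa using this

def up : ℕ → Set T → Set T
  | 0, A => A
  | k + 1, A => up k A ∪ {c | ∃ p ∈ up k A, ∃ a s e, s ∈ LabSet (code p) ∧ c = T.child p a s e}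

theorem up_finite (k : ℕ) {A : Set T} (h : A.Finite) : (up k A).Finite := by
  induction k with
  | zero => exact h
  | succ k ih =>
    refine ih.union ?_
    have : {c | ∃ p ∈ up k A, ∃ a s e, s ∈ LabSet (code p) ∧ c = T.child p a s e}
        ⊆ ⋃ p ∈ up k A, ⋃ a : Bool, ⋃ s ∈ LabSet (code p), ⋃ e : Bool, {T.child p a s e} := by
      rintro c ⟨p, hp, a, s, e, hs, rfl⟩
      simp only [Set.mem_iUnion, Set.mem_singleton_iff]
      exact ⟨p, hp, a, s, hs, e, rfl⟩
    refine Set.Finite.subset ?_ this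
    refine ih.biUnion fun p _ => ?_
    refine Set.finite_iUnion fun a => ?_
    refine (LabSet_finite _).biUnion fun s _ => ?_
    exact Set.finite_iUnion fun e => Set.finite_singleton _

theorem up_mono {k l : ℕ} (h : k ≤ l) (A : Set T) : up k A ⊆ up l A := by
  induction h with
  | refl => exact subset_rfl
  | step _ ih => exact ih.trans Set.subset_union_left

def VW (n : ℕ) (A : Set T) : Set T := up n A ∪ {p | code p ≤ n}

noncomputable def W : ℕ → Set T
  | 0 => ∅
  | n + 1 => W n ∪ {b | ∃ i, i ≤ (VW n (W n)).ncard ∧ b = T.src n i}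

noncomputable def V (n : ℕ) : Set T := VW n (W n)

theorem VW_finite (n : ℕ) {A : Set T} (h : A.Finite) : (VW n A).Finite :=
  (up_finite n h).union (finite_code_le n)

theorem W_finite (n : ℕ) : (W n).Finite := by
  induction n with
  | zero => exact Set.finite_empty
  | succ n ih =>
    refine ih.union ?_
    refine ((Set.finite_Iic ((VW n (W n)).ncard)).image (T.src n)).subset ?_
    rintro b ⟨i, hi, rfl⟩
    exact ⟨i, hi, rfl⟩

theorem V_finite (n : ℕ) : (V n).Finite := VW_finite n (W_finite n)

theorem mem_W {n m i : ℕ} (h : m < n) (hi : i ≤ (V m).ncard) : T.src m i ∈ W n := by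
  induction n with
  | zero => omega
  | succ n ih =>
    rcases Nat.lt_succ_iff_lt_or_eq.1 h with h | rfl
    · exact Or.inl (ih h)
    · exact Or.inr ⟨i, hi, rfl⟩

end MCG

namespace MCG
open Classical

noncomputable section

def S (n : ℕ) : List ℕ := Denumerable.ofNat (List ℕ) n

def site (f : ℕ → ℕ) (n : ℕ) : Prop := S n = pre f (S n).length

def fT (f : ℕ → ℕ) (t : T) : T := eqv.symm (f (eqv t))

def cidx (f : ℕ → ℕ) (n : ℕ) : ℕ := sInf {i | i ≤ (V n).ncard ∧ fT f (T.src n i) ∉ V n}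

def cc (f : ℕ → ℕ) (n : ℕ) : T := fT f (T.src n (cidx f n))

def ok (f : ℕ → ℕ) (n : ℕ) : Prop :=
  site f n ∧ cc f n ∉ V n ∧ ∀ m < n, site f m → cc f m ≠ cc f n

def bitv : T → ℕ
  | T.child _ false _ true => 1
  | _ => 0

def kind (f : ℕ → ℕ) (n : ℕ) : ℕ :=
  if ∃ m < n, ok f m ∧ qidx (cc f m) = qidx (cc f n) then
    (match qidx (cc f n) with
     | none => 0
     | some j => j + 1)
  else 0

def tl (x : ℕ → ℕ) : ℕ → ℕ := fun k => x (k + 3)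

def par (x : ℕ → ℕ) : Bool := decide (x 0 ≠ 0)

def usedK (K0 : ℕ → (ℕ → ℕ) → ℕ) (x : ℕ → ℕ) (n : ℕ) : Prop :=
  ok (tl x) n ∧ x 0 = bitv (cc (tl x) n) ∧ x 1 = kind (tl x) n ∧ x 2 = K0 n (tl x)

def ptrU (U : ℕ → Prop) (x : ℕ → ℕ) : T → Option (T × Bool)
  | T.src n i => if U n ∧ i = cidx (tl x) n then some (cc (tl x) n, true) else none
  | T.q _ _ => none
  | T.child p a s e =>
    if a = par x ∧ s = lam x p ∧ (∀ t, ptrU U x p ≠ some (t, e)) ∧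
      ¬ (e = false ∧ ∃ n, U n ∧ cc (tl x) n = p) then some (p, !e) else none

def Vis (P : (ℕ → ℕ) → T → Option (T × Bool)) : T → T → Prop
  | T.src _ _, T.src _ _ => True
  | T.child p a s e, T.child p' a' s' e' =>
    a = a' ∧ e = e' ∧ s.length < s'.length ∧ (∃ y, par y = a' ∧ s' = pre y s'.length) ∧
    (∀ y, par y = a' → s' = pre y s'.length → P y (T.child p a s e) = some (p, !e)) ∧ Vis P p p'
  | _, _ => False

def UN (K0 : ℕ → (ℕ → ℕ) → ℕ) (N : ℕ) (x : ℕ → ℕ) (n : ℕ) : Prop := n < N ∧ usedK K0 x n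

def Rel (K0 : ℕ → (ℕ → ℕ) → ℕ) (N : ℕ) (f : ℕ → ℕ) (n1 : ℕ) : Prop :=
  n1 < N ∧ ok f n1 ∧ ok f N ∧ bitv (cc f n1) = bitv (cc f N) ∧ kind f n1 = kind f N ∧
  code (cc f n1) ≤ N ∧ root (cc f n1) = T.src n1 (cidx f n1) ∧
  root (cc f N) = T.src N (cidx f N) ∧
  Vis (fun y => ptrU (UN K0 N y) y) (cc f n1) (cc f N)

def Kf : ℕ → ℕ → (ℕ → ℕ) → ℕ
  | 0 => fun _ _ => 0
  | N + 1 => Function.update (Kf N) N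
      (fun f => (Finset.range N).sup (fun n1 => if Rel (Kf N) N f n1 then Kf N n1 f + 1 else 0))

def K (n : ℕ) : (ℕ → ℕ) → ℕ := Kf (n + 1) n

theorem Kf_eq {n N : ℕ} (h : n < N) : Kf N n = K n := by
  induction N with
  | zero => omega
  | succ N ih =>
    rcases Nat.lt_succ_iff_lt_or_eq.1 h with h | rfl
    · rw [Kf, Function.update_of_ne (by omega), ih h]
    · rfl

theorem K_eq (N : ℕ) (f : ℕ → ℕ) :
    K N f = (Finset.range N).sup (fun n1 => if Rel (Kf N) N f n1 then Kf N n1 f + 1 else 0) := by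
  rw [K, Kf, Function.update_self]

theorem K_lt {N n1 : ℕ} {f : ℕ → ℕ} (h : Rel (Kf N) N f n1) : K n1 f < K N f := by
  rw [K_eq N f]
  have := Finset.le_sup (f := fun n1 => if Rel (Kf N) N f n1 then Kf N n1 f + 1 else 0)
    (Finset.mem_range.2 h.1)
  simp only [if_pos h, Kf_eq h.1] at this
  omega

theorem K_pred {N r : ℕ} {f : ℕ → ℕ} (h : K N f = r + 1) :
    ∃ n1, Rel (Kf N) N f n1 ∧ K n1 f = r := by
  rw [K_eq N f] at h
  have hne : (Finset.range N).Nonempty := by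
    by_contra hc
    rw [Finset.not_nonempty_iff_eq_empty.1 hc] at h
    simp at h
  obtain ⟨n1, h1, h2⟩ := Finset.exists_mem_eq_sup _ hne
    (fun n1 => if Rel (Kf N) N f n1 then Kf N n1 f + 1 else 0)
  rw [h2] at h
  by_cases hr : Rel (Kf N) N f n1
  · simp only [if_pos hr, Kf_eq hr.1] at h
    exact ⟨n1, hr, by omega⟩
  · simp [if_neg hr] at h

def used (x : ℕ → ℕ) (n : ℕ) : Prop := usedK K x n

def ptr (x : ℕ → ℕ) : T → Option (T × Bool) := ptrU (used x) x

theorem cidx_le (f : ℕ → ℕ) (n : ℕ) : cidx f n ≤ (V n).ncard := by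
  unfold cidx
  by_cases h : {i | i ≤ (V n).ncard ∧ fT f (T.src n i) ∉ V n}.Nonempty
  · exact (Nat.sInf_mem h).1
  · rw [Set.not_nonempty_iff_eq_empty.1 h]; simp

theorem code_le_mem_V {n : ℕ} {p : T} (h : code p ≤ n) : p ∈ V n := Or.inr h

theorem ok.lt {f : ℕ → ℕ} {n : ℕ} (h : ok f n) : n < code (cc f n) := by
  by_contra hc
  exact h.2.1 (code_le_mem_V (by omega))

theorem used.ok {x : ℕ → ℕ} {n : ℕ} (h : used x n) : ok (tl x) n := h.1

theorem cc_inj {f : ℕ → ℕ} {n m : ℕ} (h : ok f n) (h' : ok f m) (he : cc f n = cc f m) : n = m := by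
  rcases lt_trichotomy n m with hl | hl | hl
  · exact absurd he (h'.2.2 n hl h.1)
  · exact hl
  · exact absurd he.symm (h.2.2 m hl h'.1)

theorem UN_Kf_iff {N n : ℕ} {x : ℕ → ℕ} : UN (Kf N) N x n ↔ n < N ∧ used x n := by
  unfold UN used usedK
  constructor
  · rintro ⟨h, h1, h2, h3, h4⟩
    rw [Kf_eq h] at h4
    exact ⟨h, h1, h2, h3, h4⟩
  · rintro ⟨h, h1, h2, h3, h4⟩
    rw [← Kf_eq h] at h4
    exact ⟨h, h1, h2, h3, h4⟩

theorem trunc {N : ℕ} {x : ℕ → ℕ} {p : T} (h : code p ≤ N) :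
    ptrU (UN (Kf N) N x) x p = ptr x p := by
  induction p with
  | src n i =>
    have := lt_code_src n i
    have h1 : n < N := by omega
    simp only [ptr, ptrU, UN_Kf_iff, h1, true_and]
  | q j i => rfl
  | child p a s e ih =>
    have h1 := code_child p a s e
    have h2 := ih (by omega)
    have h3 : (∃ n, UN (Kf N) N x n ∧ cc (tl x) n = p) ↔ (∃ n, used x n ∧ cc (tl x) n = p) := by
      constructor
      · rintro ⟨n, h, h'⟩; exact ⟨n, (UN_Kf_iff.1 h).2, h'⟩
      · rintro ⟨n, h, h'⟩
        refine ⟨n, UN_Kf_iff.2 ⟨?_, h⟩, h'⟩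
        have := h.ok.lt
        rw [h'] at this; omega
    simp only [ptr, ptrU] at h2 ⊢
    rw [h2]
    simp only [h3]

theorem ptr_src {x : ℕ → ℕ} {n i : ℕ} : ptr x (T.src n i) =
    if used x n ∧ i = cidx (tl x) n then some (cc (tl x) n, true) else none := rfl

theorem ptr_q {x : ℕ → ℕ} {n i : ℕ} : ptr x (T.q n i) = none := rfl

theorem ptr_child {x : ℕ → ℕ} {p : T} {a s e} : ptr x (T.child p a s e) =
    if a = par x ∧ s = lam x p ∧ (∀ t, ptr x p ≠ some (t, e)) ∧
      ¬ (e = false ∧ ∃ n, used x n ∧ cc (tl x) n = p) then some (p, !e) else none := rfl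

theorem ptr_used {x : ℕ → ℕ} {n : ℕ} (h : used x n) :
    ptr x (T.src n (cidx (tl x) n)) = some (cc (tl x) n, true) := by
  rw [ptr_src, if_pos ⟨h, rfl⟩]

theorem ptr_cc {x : ℕ → ℕ} {n : ℕ} (h : used x n) (t : T) :
    ptr x (cc (tl x) n) ≠ some (t, false) := by
  intro hp
  have hb := h.2.1
  cases hc : cc (tl x) n with
  | src m i =>
    rw [hc, ptr_src] at hp
    split_ifs at hp
    simp at hp
  | q j i => rw [hc, ptr_q] at hp; simp at hp
  | child p a s e =>
    rw [hc, ptr_child] at hp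
    split_ifs at hp with h1
    rw [hc] at hb
    simp only [Option.some.injEq, Prod.mk.injEq] at hp
    have he : e = true := by simpa using hp.2
    subst he
    have h2 := h1.1
    unfold par at h2
    cases a
    · simp [bitv] at hb; simp [hb] at h2
    · simp [bitv] at hb; simp [hb] at h2

def act (x : ℕ → ℕ) (e : Bool) (p : T) : T :=
  if h : ∃ t, ptr x p = some (t, e) then h.choose
  else if h : e = false ∧ ∃ n, used x n ∧ cc (tl x) n = p then
    T.src h.2.choose (cidx (tl x) h.2.choose)
  else T.child p (par x) (lam x p) e

theorem act_down {x : ℕ → ℕ} {e : Bool} {p t : T} (h : ptr x p = some (t, e)) : act x e p = t := by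
  have h' : ∃ t, ptr x p = some (t, e) := ⟨t, h⟩
  have h2 := h'.choose_spec
  unfold act
  rw [dif_pos h']
  have h3 := h2.symm.trans h
  simpa using h3

theorem act_cc {x : ℕ → ℕ} {n : ℕ} (h : used x n) :
    act x false (cc (tl x) n) = T.src n (cidx (tl x) n) := by
  have h1 : ¬ ∃ t, ptr x (cc (tl x) n) = some (t, false) := by
    rintro ⟨t, ht⟩; exact ptr_cc h t ht
  have h2 : false = false ∧ ∃ m, used x m ∧ cc (tl x) m = cc (tl x) n := ⟨rfl, n, h, rfl⟩
  unfold act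
  rw [dif_neg h1, dif_pos h2]
  have h3 := h2.2.choose_spec
  have := cc_inj h3.1.ok h.ok h3.2
  rw [this]

theorem act_child {x : ℕ → ℕ} {e : Bool} {p : T} (h : ∀ t, ptr x p ≠ some (t, e))
    (h' : ¬ (e = false ∧ ∃ n, used x n ∧ cc (tl x) n = p)) :
    act x e p = T.child p (par x) (lam x p) e := by
  unfold act
  rw [dif_neg (by push Not; exact h), dif_neg h']

theorem act_cases (x : ℕ → ℕ) (e : Bool) (p : T) :
    (ptr x p = some (act x e p, e)) ∨ ptr x (act x e p) = some (p, !e) := by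
  by_cases h : ∃ t, ptr x p = some (t, e)
  · obtain ⟨t, ht⟩ := h
    left; rw [act_down ht, ht]
  · right
    by_cases h2 : e = false ∧ ∃ n, used x n ∧ cc (tl x) n = p
    · obtain ⟨rfl, n, h3, rfl⟩ := h2
      rw [act_cc h3, ptr_used h3]; rfl
    · push Not at h
      rw [act_child h h2, ptr_child, if_pos ⟨rfl, rfl, h, h2⟩]

theorem ptr_back {x : ℕ → ℕ} {e : Bool} {p t : T} (h : ptr x p = some (t, e)) :
    act x (!e) t = p := by
  cases p with
  | src n i =>
    rw [ptr_src] at h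
    split_ifs at h with h1
    simp only [Option.some.injEq, Prod.mk.injEq] at h
    obtain ⟨rfl, rfl⟩ := h
    rw [h1.2]
    exact act_cc h1.1
  | q j i => rw [ptr_q] at h; simp at h
  | child p a s e0 =>
    rw [ptr_child] at h
    split_ifs at h with h1
    simp only [Option.some.injEq, Prod.mk.injEq] at h
    obtain ⟨rfl, rfl⟩ := h
    rw [Bool.not_not, act_child h1.2.2.1 h1.2.2.2, h1.1, h1.2.1]

theorem act_act (x : ℕ → ℕ) (e : Bool) (p : T) : act x (!e) (act x e p) = p := by
  rcases act_cases x e p with h | h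
  · exact ptr_back h
  · exact act_down h

def g (x : ℕ → ℕ) : Equiv.Perm T where
  toFun := act x true
  invFun := act x false
  left_inv p := act_act x true p
  right_inv p := act_act x false p

theorem g_apply (x : ℕ → ℕ) (p : T) : g x p = act x true p := rfl
theorem g_inv_apply (x : ℕ → ℕ) (p : T) : (g x)⁻¹ p = act x false p := rfl

end

end MCG

namespace MCG
open Classical

noncomputable section

def Dep {α : Type} (F : (ℕ → ℕ) → α) : Prop :=
  ∃ M, ∀ x y : ℕ → ℕ, (∀ k < M, x k = y k) → F x = F y

theorem Dep.const {α : Type} (a : α) : Dep (fun _ => a) := ⟨0, fun _ _ _ => rfl⟩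

theorem Dep.map {α β : Type} {F : (ℕ → ℕ) → α} (h : Dep F) (G : α → β) :
    Dep (fun x => G (F x)) := by
  obtain ⟨M, hM⟩ := h
  exact ⟨M, fun x y hxy => congrArg G (hM x y hxy)⟩

theorem Dep.pair {α β : Type} {F : (ℕ → ℕ) → α} {G : (ℕ → ℕ) → β} (h : Dep F) (h' : Dep G) :
    Dep (fun x => (F x, G x)) := by
  obtain ⟨M, hM⟩ := h
  obtain ⟨M', hM'⟩ := h'
  refine ⟨max M M', fun x y hxy => ?_⟩
  simp only
  rw [hM x y fun k hk => hxy k (lt_of_lt_of_le hk (le_max_left _ _)),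
    hM' x y fun k hk => hxy k (lt_of_lt_of_le hk (le_max_right _ _))]

theorem Dep.map2 {α β γ : Type} {F : (ℕ → ℕ) → α} {G : (ℕ → ℕ) → β} (h : Dep F) (h' : Dep G)
    (H : α → β → γ) : Dep (fun x => H (F x) (G x)) :=
  (h.pair h').map (fun p => H p.1 p.2)

theorem Dep.and {F G : (ℕ → ℕ) → Prop} (h : Dep F) (h' : Dep G) : Dep (fun x => F x ∧ G x) :=
  h.map2 h' _

theorem Dep.eq {α : Type} {F G : (ℕ → ℕ) → α} (h : Dep F) (h' : Dep G) :
    Dep (fun x => F x = G x) :=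
  h.map2 h' _

theorem Dep.imp {F G : (ℕ → ℕ) → Prop} (h : Dep F) (h' : Dep G) : Dep (fun x => F x → G x) :=
  h.map2 h' (fun a b => (a → b))

theorem Dep.not {F : (ℕ → ℕ) → Prop} (h : Dep F) : Dep (fun x => ¬ F x) :=
  h.map _

theorem Dep.ite {α : Type} {C : (ℕ → ℕ) → Prop} {F G : (ℕ → ℕ) → α}
    {inst : ∀ x, Decidable (C x)} (h0 : Dep C) (h : Dep F)
    (h' : Dep G) : Dep (fun x => if C x then F x else G x) := by
  have := h0.map2 (h.pair h') (fun c p => if c then p.1 else p.2)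
  convert this

theorem Dep.fam {α : Type} {F : ℕ → (ℕ → ℕ) → α} (h : ∀ n, Dep (F n)) (N : ℕ) :
    ∃ M, ∀ x y : ℕ → ℕ, (∀ k < M, x k = y k) → ∀ n < N, F n x = F n y := by
  choose M hM using h
  refine ⟨(Finset.range N).sup M, fun x y hxy n hn => hM n x y fun k hk => hxy k ?_⟩
  exact lt_of_lt_of_le hk (Finset.le_sup (f := M) (Finset.mem_range.2 hn))

theorem Dep.bex {F : ℕ → (ℕ → ℕ) → Prop} (h : ∀ n, Dep (F n)) (N : ℕ) :
    Dep (fun x => ∃ n < N, F n x) := by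
  obtain ⟨M, hM⟩ := Dep.fam h N
  refine ⟨M, fun x y hxy => propext ?_⟩
  constructor
  · rintro ⟨n, hn, h⟩; exact ⟨n, hn, hM x y hxy n hn ▸ h⟩
  · rintro ⟨n, hn, h⟩; exact ⟨n, hn, (hM x y hxy n hn).symm ▸ h⟩

theorem Dep.ball {F : ℕ → (ℕ → ℕ) → Prop} (h : ∀ n, Dep (F n)) (N : ℕ) :
    Dep (fun x => ∀ n < N, F n x) := by
  have := (Dep.bex (fun n => (h n).not) N).not
  convert this using 2
  push Not
  rfl

theorem Dep.tl {α : Type} {F : (ℕ → ℕ) → α} (h : Dep F) : Dep (fun x => F (tl x)) := by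
  obtain ⟨M, hM⟩ := h
  exact ⟨M + 3, fun x y hxy => hM _ _ fun k hk => hxy _ (by omega)⟩

theorem Dep.coord (k : ℕ) : Dep (fun x => x k) := ⟨k + 1, fun x y h => h k (by omega)⟩

theorem dep_site (n : ℕ) : Dep (fun f => site f n) :=
  ⟨(S n).length, fun x y h => by unfold site; beta_reduce; rw [pre_congr h]⟩

theorem dep_fT (t : T) : Dep (fun f => fT f t) := (Dep.coord (eqv t)).map _

theorem dep_cidx (n : ℕ) : Dep (fun f => cidx f n) := by
  obtain ⟨M, hM⟩ := Dep.fam (fun i => dep_fT (T.src n i)) ((V n).ncard + 1)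
  refine ⟨M, fun x y hxy => ?_⟩
  unfold cidx
  beta_reduce
  congr 1
  ext i
  apply and_congr_right
  intro hi
  rw [hM x y hxy i (by omega)]

theorem dep_cc (n : ℕ) : Dep (fun f => cc f n) := by
  obtain ⟨M, hM⟩ := Dep.fam (fun i => dep_fT (T.src n i)) ((V n).ncard + 1)
  obtain ⟨M', hM'⟩ := dep_cidx n
  refine ⟨max M M', fun x y hxy => ?_⟩
  unfold cc
  beta_reduce at hM' ⊢
  rw [hM' x y fun k hk => hxy k (lt_of_lt_of_le hk (le_max_right _ _))]
  have := cidx_le y n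
  rw [hM x y (fun k hk => hxy k (lt_of_lt_of_le hk (le_max_left _ _))) _ (by omega)]

theorem dep_ok (n : ℕ) : Dep (fun f => ok f n) :=
  (dep_site n).and (((dep_cc n).map (fun c => c ∉ V n)).and
    (Dep.ball (fun m => (dep_site m).imp ((dep_cc m).eq (dep_cc n)).not) n))

theorem dep_kind (n : ℕ) : Dep (fun f => kind f n) := by
  unfold kind
  apply Dep.ite
  · exact Dep.bex (fun m => (dep_ok m).and
      (((dep_cc m).map qidx).eq ((dep_cc n).map qidx))) n
  · exact (dep_cc n).map (fun c => match qidx c with | none => 0 | some j => j + 1)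
  · exact Dep.const _

theorem dep_Rel (K0 : ℕ → (ℕ → ℕ) → ℕ) (N n1 : ℕ) : Dep (fun f => Rel K0 N f n1) := by
  unfold Rel
  refine (Dep.const _).and ((dep_ok _).and ((dep_ok _).and ?_))
  refine (((dep_cc _).map _).eq ((dep_cc _).map _)).and ?_
  refine ((dep_kind _).eq (dep_kind _)).and ?_
  refine ((dep_cc _).map (fun c => code c ≤ N)).and ?_
  refine (((dep_cc _).map root).eq ((dep_cidx _).map (T.src n1))).and ?_
  refine (((dep_cc _).map root).eq ((dep_cidx _).map (T.src N))).and ?_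
  exact (dep_cc n1).map2 (dep_cc N) _

theorem dep_Kf (N n : ℕ) : Dep (fun f => Kf N n f) := by
  induction N generalizing n with
  | zero => exact Dep.const 0
  | succ N ih =>
    simp only [Kf]
    by_cases h : n = N
    · subst h
      simp only [Function.update_self]
      obtain ⟨M, hM⟩ := Dep.fam (fun n1 => (dep_Rel (Kf n) n n1).ite ((ih n1).map (· + 1))
        (Dep.const 0)) n
      refine ⟨M, fun x y hxy => Finset.sup_congr rfl fun n1 hn => hM x y hxy n1 (Finset.mem_range.1 hn)⟩
    · simp only [Function.update_of_ne h]
      exact ih n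

theorem dep_used (n : ℕ) : Dep (fun x => used x n) := by
  unfold used usedK
  refine (dep_ok n).tl.and ?_
  refine ((Dep.coord 0).eq ((dep_cc n).map bitv).tl).and ?_
  refine ((Dep.coord 1).eq (dep_kind n).tl).and ?_
  exact (Dep.coord 2).eq (dep_Kf (n + 1) n).tl

theorem dep_lam (p : T) : Dep (fun x => lam x p) := ⟨code p, fun _ _ h => lam_congr h⟩

theorem dep_par : Dep par := (Dep.coord 0).map (fun a => decide (a ≠ 0))

theorem dep_excc (p : T) : Dep (fun x => ∃ n, used x n ∧ cc (tl x) n = p) := by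
  have := Dep.bex (fun n => (dep_used n).and ((dep_cc n).tl.eq (Dep.const p))) (code p)
  convert this using 2 with x
  constructor
  · rintro ⟨n, h, h'⟩
    have := h.ok.lt
    rw [h'] at this
    exact ⟨n, this, h, h'⟩
  · rintro ⟨n, _, h⟩; exact ⟨n, h⟩

theorem dep_ptr (p : T) : Dep (fun x => ptr x p) := by
  induction p with
  | src n i =>
    simp only [ptr_src]
    exact ((dep_used n).and ((Dep.const i).eq (dep_cidx n).tl)).ite
      ((dep_cc n).tl.map (fun c => some (c, true))) (Dep.const _)
  | q j i => exact Dep.const _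
  | child p a s e ih =>
    simp only [ptr_child]
    refine Dep.ite ?_ (Dep.const _) (Dep.const _)
    refine ((Dep.const a).eq dep_par).and ?_
    refine ((Dep.const s).eq (dep_lam p)).and ?_
    refine (ih.map (fun o => ∀ t, o ≠ some (t, e))).and ?_
    exact ((Dep.const _).and (dep_excc p)).not

theorem dep_act (e : Bool) (p : T) : Dep (fun x => act x e p) := by
  obtain ⟨M1, h1⟩ := dep_ptr p
  obtain ⟨M2, h2⟩ := (dep_excc p)
  obtain ⟨M3, h3⟩ := Dep.fam (fun n => (dep_used n).pair ((dep_cc n).tl.pair (dep_cidx n).tl)) (code p)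
  obtain ⟨M4, h4⟩ := dep_par.pair (dep_lam p)
  refine ⟨max (max M1 M2) (max M3 M4), fun x y hxy => ?_⟩
  beta_reduce at h1 h2 ⊢
  simp only [lt_max_iff] at hxy
  replace h1 := h1 x y fun k hk => hxy k (by tauto)
  replace h2 := h2 x y fun k hk => hxy k (by tauto)
  replace h3 := h3 x y fun k hk => hxy k (by tauto)
  replace h4 := h4 x y fun k hk => hxy k (by tauto)
  simp only [Prod.mk.injEq] at h3 h4
  by_cases c1 : ∃ t, ptr x p = some (t, e)
  · obtain ⟨t, ht⟩ := c1
    rw [act_down ht, act_down (h1 ▸ ht)]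
  · push Not at c1
    by_cases c2 : e = false ∧ ∃ n, used x n ∧ cc (tl x) n = p
    · obtain ⟨rfl, n, hn, hc⟩ := c2
      have hl := hn.ok.lt
      rw [hc] at hl
      obtain ⟨i1, i2, i3⟩ := h3 n hl
      have e1 := act_cc hn
      have hn' : used y n := i1 ▸ hn
      have e2 := act_cc hn'
      rw [hc] at e1
      rw [← i2, hc] at e2
      rw [e1, e2, i3]
    · rw [act_child c1 c2, act_child (h1 ▸ c1) (h2 ▸ c2), h4.1, h4.2]

end
end MCG

namespace MCG
open Classical

noncomputable section

theorem used_unique {x y : ℕ → ℕ} {n : ℕ} (hx : used x n) (hy : used y n) (h : tl x = tl y) :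
    x = y := by
  funext k
  match k with
  | 0 => rw [hx.2.1, hy.2.1, h]
  | 1 => rw [hx.2.2.1, hy.2.2.1, h]
  | 2 => rw [hx.2.2.2, hy.2.2.2, h]
  | k + 3 => exact congrFun h k

theorem site_encode {f : ℕ → ℕ} {n : ℕ} (h : site f n) :
    n = Encodable.encode (pre f (S n).length) := by
  rw [← h, S, Denumerable.encode_ofNat]

theorem common_sites {f f' : ℕ → ℕ} (h : f ≠ f') : {n | site f n ∧ site f' n}.Finite := by
  obtain ⟨k, hk⟩ := Function.ne_iff.1 h
  refine ((Set.finite_Iic k).image (fun l => Encodable.encode (pre f l))).subset ?_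
  rintro n ⟨h1, h2⟩
  refine ⟨(S n).length, ?_, (site_encode h1).symm⟩
  by_contra hc
  simp only [Set.mem_Iic, not_le] at hc
  exact hk (pre_eq_iff.1 (h1.symm.trans h2) k hc)

theorem E_finite {x y : ℕ → ℕ} (h : x ≠ y) : {p | ptr x p ≠ none ∧ ptr y p ≠ none}.Finite := by
  obtain ⟨P, hP⟩ := lam_sep h
  have h1 : (⋃ p ∈ {p | code p ≤ P}, ⋃ a : Bool, ⋃ e : Bool, {T.child p a (lam x p) e}).Finite := by
    refine (finite_code_le P).biUnion fun p _ => ?_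
    exact Set.finite_iUnion fun a => Set.finite_iUnion fun e => Set.finite_singleton _
  by_cases ht : tl x = tl y
  · refine h1.subset ?_
    rintro p ⟨hx, hy⟩
    cases p with
    | src n i =>
      rw [ptr_src] at hx hy
      split_ifs at hx hy with h2 h3
      · exact absurd (used_unique h2.1 h3.1 ht) h
      all_goals simp at hx hy
    | q j i => exact absurd rfl hx
    | child p a s e =>
      rw [ptr_child] at hx hy
      split_ifs at hx hy with h2 h3
      · simp only [Set.mem_iUnion, Set.mem_singleton_iff]
        refine ⟨p, ?_, a, e, by rw [h2.2.1]⟩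
        show code p ≤ P
        by_contra hc
        exact hP p (by omega) (h2.2.1.symm.trans h3.2.1)
      all_goals simp at hx hy
  · refine (h1.union ((common_sites ht).image (fun n => T.src n (cidx (tl x) n)))).subset ?_
    rintro p ⟨hx, hy⟩
    cases p with
    | src n i =>
      rw [ptr_src] at hx hy
      split_ifs at hx hy with h2 h3
      · right
        exact ⟨n, ⟨h2.1.1.1, h3.1.1.1⟩, by rw [h2.2]⟩
      all_goals simp at hx hy
    | q j i => exact absurd rfl hx
    | child p a s e =>
      rw [ptr_child] at hx hy
      split_ifs at hx hy with h2 h3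
      · left
        simp only [Set.mem_iUnion, Set.mem_singleton_iff]
        refine ⟨p, ?_, a, e, by rw [h2.2.1]⟩
        show code p ≤ P
        by_contra hc
        exact hP p (by omega) (h2.2.1.symm.trans h3.2.1)
      all_goals simp at hx hy

/-- Descent along a list of letters. -/
def TDl : List ((ℕ → ℕ) × Bool) → T → T → Prop
  | [], p, t => p = t
  | y :: ys, p, t => ∃ p' a s, p = T.child p' a s y.2 ∧ ptr y.1 p = some (p', !y.2) ∧ TDl ys p' t

theorem TDl_code {ys : List ((ℕ → ℕ) × Bool)} {p t : T} (h : TDl ys p t) : code t ≤ code p := by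
  induction ys generalizing p with
  | nil => rw [show p = t from h]
  | cons y ys ih =>
    obtain ⟨p', a, s, rfl, _, h2⟩ := h
    exact (ih h2).trans (code_child _ _ _ _).le

theorem TDl_root {ys : List ((ℕ → ℕ) × Bool)} {p t : T} (h : TDl ys p t) : root t = root p := by
  induction ys generalizing p with
  | nil => rw [show p = t from h]
  | cons y ys ih =>
    obtain ⟨p', a, s, rfl, _, h2⟩ := h
    have h3 := ih h2
    exact h3

theorem TDl_Vis {ys : List ((ℕ → ℕ) × Bool)} {n1 i1 : ℕ} {c1 : T} (h : TDl ys c1 (T.src n1 i1)) :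
    ∃ M, ∀ n2 ≥ M, ∀ i2 c2, TDl ys c2 (T.src n2 i2) →
      Vis (fun y => ptrU (UN (Kf n2) n2 y) y) c1 c2 := by
  induction ys generalizing c1 with
  | nil =>
    refine ⟨0, fun n2 _ i2 c2 h2 => ?_⟩
    rw [show c1 = _ from h, show c2 = _ from h2]
    trivial
  | cons y ys ih =>
    obtain ⟨p, a, s, rfl, hp, h2⟩ := h
    obtain ⟨M0, hM0⟩ := ih h2
    obtain ⟨M1, hM1⟩ := dep_ptr (T.child p a s y.2)
    obtain ⟨P, hP⟩ := lam_long y.1 (max M1 (s.length + 1))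
    refine ⟨max M0 (max P (code (T.child p a s y.2))), fun n2 hn2 i2 c2 h' => ?_⟩
    have hn2 : M0 ≤ n2 ∧ P ≤ n2 ∧ code (T.child p a s y.2) ≤ n2 := by
      simpa [max_le_iff] using hn2
    obtain ⟨p', a', s', rfl, hp', h2'⟩ := h'
    have hc := TDl_code h2'
    have hc' := lt_code_src n2 i2
    have hl := hP p' (by omega)
    have hpp := hp
    have hpp' := hp'
    rw [ptr_child] at hp hp'
    split_ifs at hp hp' with g1 g2
    have hl' : max M1 (s.length + 1) ≤ s'.length := by rw [g2.2.1]; exact hl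
    have hs' : s' = pre y.1 s'.length := by
      conv_lhs => rw [g2.2.1]
      conv_rhs => rw [g2.2.1]
      exact lam_eq_pre _ _
    refine ⟨g1.1.trans g2.1.symm, rfl, by omega, ⟨y.1, g2.1.symm, hs'⟩, ?_, hM0 n2 hn2.1 i2 p' h2'⟩
    intro y' _ hy'
    simp only
    rw [trunc hn2.2.2, ← hpp]
    apply hM1
    intro k hk
    exact pre_eq_iff.1 (hy'.symm.trans hs') k (by omega)

theorem lemB (x : ℕ → ℕ) (ys : List ((ℕ → ℕ) × Bool)) :
    {n | used x n ∧ TDl ys (cc (tl x) n) (T.src n (cidx (tl x) n))}.Finite := by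
  by_contra hinf
  have hinf : {n | used x n ∧ TDl ys (cc (tl x) n) (T.src n (cidx (tl x) n))}.Infinite := hinf
  obtain ⟨n1, h1, h1'⟩ := hinf.nonempty
  obtain ⟨M, hM⟩ := TDl_Vis h1'
  obtain ⟨n2, ⟨h2, h2'⟩, hn2⟩ := hinf.exists_gt (max M (max n1 (code (cc (tl x) n1))))
  have hn2 : M < n2 ∧ n1 < n2 ∧ code (cc (tl x) n1) < n2 := by
    simpa [max_lt_iff] using hn2
  have hr : Rel (Kf n2) n2 (tl x) n1 := by
    refine ⟨hn2.2.1, h1.1, h2.1, ?_, ?_, hn2.2.2.le, ?_, ?_, hM n2 hn2.1.le _ _ h2'⟩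
    · rw [← h1.2.1, h2.2.1]
    · rw [← h1.2.2.1, h2.2.2.1]
    · exact (TDl_root h1').symm
    · exact (TDl_root h2').symm
  have := K_lt hr
  have e1 := h1.2.2.2
  have e2 := h2.2.2.2
  omega

theorem lemA {Xs : Set (ℕ → ℕ)} (hX : Xs.Finite) (m : ℕ) (hm : 0 < m) :
    ∃ B : Set T, B.Finite ∧ ∀ D : ℕ → T, (∀ k, D (k + m) = D k) →
      (∀ k, ∃ x ∈ Xs, ∃ e, ptr x (D k) = some (D (k + 1), e)) → ∃ k, D k ∈ B := by
  -- threshold for common sites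
  have hN : ∃ N, ∀ x ∈ Xs, ∀ y ∈ Xs, ∀ n, site (tl x) n → site (tl y) n → N < n → tl x = tl y := by
    have : (⋃ x ∈ Xs, ⋃ y ∈ Xs, {n | tl x ≠ tl y ∧ site (tl x) n ∧ site (tl y) n}).Finite := by
      refine hX.biUnion fun x _ => hX.biUnion fun y _ => ?_
      by_cases h : tl x = tl y
      · simp [h]
      · exact (common_sites h).subset fun n hn => hn.2
    obtain ⟨N, hN⟩ := this.bddAbove
    refine ⟨N, fun x hx y hy n h1 h2 hn => ?_⟩
    by_contra hc
    have : n ≤ N := hN (by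
      simp only [Set.mem_iUnion]
      exact ⟨x, hx, y, hy, hc, h1, h2⟩)
    omega
  obtain ⟨N, hN⟩ := hN
  have : Finite Xs := hX
  let zz : List (Xs × Bool) → List ((ℕ → ℕ) × Bool) := List.map (fun z => (z.1.1, z.2))
  let B0 : Set T := ⋃ x ∈ Xs, (fun n => T.src n (cidx (tl x) n)) '' Set.Iic (max N m)
  let B1 : Set T := ⋃ x ∈ Xs, ⋃ zs ∈ {zs : List (Xs × Bool) | zs.length ≤ m},
    (fun n => T.src n (cidx (tl x) n)) ''
      {n | used x n ∧ TDl (zz zs) (cc (tl x) n) (T.src n (cidx (tl x) n))}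
  refine ⟨B0 ∪ B1, ?_, ?_⟩
  · refine Set.Finite.union ?_ ?_
    · exact hX.biUnion fun x _ => (Set.finite_Iic _).image _
    · exact hX.biUnion fun x _ => (List.finite_length_le _ _).biUnion fun zs _ => (lemB x _).image _
  intro D hper hstep
  have hper' : ∀ j k, D (k + m * j) = D k := by
    intro j
    induction j with
    | zero => intro k; simp
    | succ j ih => intro k; rw [Nat.mul_succ, ← Nat.add_assoc, hper, ih]
  have hmod : ∀ k, D (k % m) = D k := by
    intro k
    conv_rhs => rw [← Nat.mod_add_div k m]
    rw [hper']
  -- tree steps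
  have htree : ∀ k, (¬ ∃ n i, D k = T.src n i) → code (D (k + 1)) < code (D k) := by
    intro k hk
    obtain ⟨x, hx, e, he⟩ := hstep k
    cases hD : D k with
    | src n i => exact absurd ⟨n, i, hD⟩ hk
    | q j i => rw [hD, ptr_q] at he; simp at he
    | child p a s e0 =>
      rw [hD, ptr_child] at he
      split_ifs at he
      simp only [Option.some.injEq, Prod.mk.injEq] at he
      rw [← he.1]
      exact code_child _ _ _ _
  have hnext : ∀ k, ∃ j, j < m ∧ ∃ n i, D (k + j) = T.src n i := by
    intro k
    by_contra hc
    push Not at hc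
    have : ∀ j, j ≤ m → code (D (k + j)) + j ≤ code (D k) := by
      intro j
      induction j with
      | zero => intro _; simp
      | succ j ih =>
        intro hj
        have h1 := ih (by omega)
        have h2 := htree (k + j) (by push Not; exact hc j (by omega))
        change code (D (k + j + 1)) + (j + 1) ≤ _
        omega
    have := this m le_rfl
    rw [hper] at this
    omega
  -- maximal source
  let A : Set ℕ := {n | ∃ k i, D k = T.src n i}
  have hAfin : A.Finite := by
    refine ((Set.finite_Iio m).image (fun k => code (D k))).bddAbove |>.elim fun b hb => ?_
    refine (Set.finite_Iic b).subset ?_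
    rintro n ⟨k, i, hk⟩
    have h1 : code (D (k % m)) ≤ b := hb ⟨k % m, Nat.mod_lt _ hm, rfl⟩
    rw [hmod, hk] at h1
    have := lt_code_src n i
    show n ≤ b
    omega
  have hAne : A.Nonempty := by
    obtain ⟨j, _, n, i, h⟩ := hnext 0
    exact ⟨n, _, i, h⟩
  obtain ⟨n, hnA, hmax⟩ := Set.exists_max_image A id hAfin hAne
  obtain ⟨k, i, hk⟩ := hnA
  obtain ⟨x, hx, e, he⟩ := hstep k
  rw [hk, ptr_src] at he
  split_ifs at he with hu
  obtain ⟨hu, rfl⟩ := hu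
  simp only [Option.some.injEq, Prod.mk.injEq] at he
  refine ⟨k, ?_⟩
  by_cases hnN : n ≤ max N m
  · left
    simp only [B0, Set.mem_iUnion]
    exact ⟨x, hx, n, hnN, hk.symm⟩
  right
  have hnN : N < n ∧ m < n := by
    simpa [max_lt_iff] using hnN
  -- next source
  have hex := hnext (k + 1)
  let j := Nat.find hex
  obtain ⟨hjm, n', i', hj⟩ := Nat.find_spec hex
  have hmin : ∀ l < j, ¬ ∃ n i, D (k + 1 + l) = T.src n i := by
    intro l hl h
    have h1 : j ≤ l := Nat.find_min' hex ⟨lt_trans hl hjm, h⟩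
    omega
  change D (k + 1 + j) = _ at hj
  change j < m at hjm
  obtain ⟨x', hx', e', he'⟩ := hstep (k + 1 + j)
  rw [hj, ptr_src] at he'
  split_ifs at he' with hu'
  obtain ⟨hu', rfl⟩ := hu'
  have hle : n' ≤ n := hmax n' ⟨_, _, hj⟩
  have hdesc : ∀ l, l ≤ j → ∃ zs : List (Xs × Bool), zs.length = l ∧
      TDl (zz zs) (D (k + 1 + (j - l))) (D (k + 1 + j)) := by
    intro l
    induction l with
    | zero => intro _; exact ⟨[], rfl, rfl⟩
    | succ l ih =>
      intro hl
      obtain ⟨zs, hzs, ht⟩ := ih (by omega)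
      obtain ⟨y, hy, e1, h1⟩ := hstep (k + 1 + (j - (l + 1)))
      have hns := hmin (j - (l + 1)) (by omega)
      have hsucc : k + 1 + (j - (l + 1)) + 1 = k + 1 + (j - l) := by omega
      rw [hsucc] at h1
      cases hD : D (k + 1 + (j - (l + 1))) with
      | src n i => exact absurd ⟨n, i, hD⟩ hns
      | q a i => rw [hD, ptr_q] at h1; simp at h1
      | child p a s e0 =>
        have h2 := h1
        rw [hD, ptr_child] at h1
        split_ifs at h1
        simp only [Option.some.injEq, Prod.mk.injEq] at h1
        refine ⟨(⟨y, hy⟩, e0) :: zs, by simp [hzs], p, a, s, rfl, ?_, ?_⟩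
        · rw [hD, ← h1.1, ← h1.2] at h2
          exact h2
        · rw [h1.1]; exact ht
  obtain ⟨zs, hzs, hT⟩ := hdesc j le_rfl
  rw [Nat.sub_self, Nat.add_zero, ← he.1, hj] at hT
  rcases Nat.lt_or_ge n' n with hlt | hge
  · exfalso
    have hW : T.src n' (cidx (tl x') n') ∈ W n := mem_W hlt (cidx_le _ _)
    have key : ∀ (ys : List ((ℕ → ℕ) × Bool)) (p : T), TDl ys p (T.src n' (cidx (tl x') n')) →
        p ∈ up ys.length (W n) := by
      intro ys
      induction ys with
      | nil => intro p hp; rw [show p = _ from hp]; exact hW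
      | cons y ys ih =>
        intro p hp
        obtain ⟨p', a, s, rfl, h1, h2⟩ := hp
        right
        refine ⟨p', ih p' h2, a, s, y.2, ?_, rfl⟩
        rw [ptr_child] at h1
        split_ifs at h1 with h3
        rw [h3.2.1]
        apply lam_mem
        rw [← qidx_root, ← TDl_root h2]
        rfl
    have h1 := key _ _ hT
    have h2 : (zz zs).length ≤ n := by simp only [zz, List.length_map]; omega
    exact hu.ok.2.1 (Or.inl (up_mono h2 _ h1))
  · obtain rfl : n' = n := by omega
    have ht := hN x hx x' hx' n' hu.1.1 hu'.1.1 hnN.1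
    rw [← ht] at hT
    simp only [B1, Set.mem_iUnion]
    exact ⟨x, hx, zs, show zs.length ≤ m by omega, n', ⟨hu, hT⟩, hk.symm⟩

end
end MCG

namespace MCG
open Classical

noncomputable section

def run (L : List ((ℕ → ℕ) × Bool)) (p : T) : T := L.foldr (fun l p => act l.1 l.2 p) p

@[simp] theorem run_nil (p : T) : run [] p = p := rfl
@[simp] theorem run_cons (l) (L : List ((ℕ → ℕ) × Bool)) (p : T) :
    run (l :: L) p = act l.1 l.2 (run L p) := rfl

def phi : FreeGroup (ℕ → ℕ) →* Equiv.Perm T := FreeGroup.lift g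

theorem phi_mk (L : List ((ℕ → ℕ) × Bool)) (p : T) : phi (FreeGroup.mk L) p = run L p := by
  unfold phi
  rw [FreeGroup.lift_mk]
  induction L with
  | nil => rfl
  | cons l L ih =>
    rw [List.map_cons, List.prod_cons, Equiv.Perm.mul_apply, ih, run_cons]
    cases h : l.2 <;> simp [g_apply, g_inv_apply]

theorem cyc_core (l : ℕ → (ℕ → ℕ) × Bool) (m : ℕ) (hm : 0 < m) (hl : ∀ k, l (k + m) = l k)
    (hred : ∀ k, (l k).1 = (l (k + 1)).1 → (l k).2 = (l (k + 1)).2) :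
    ∃ B : Set T, B.Finite ∧ ∀ P : ℕ → T, (∀ k, P (k + 1) = act (l k).1 (l k).2 (P k)) →
      (∀ k, P (k + m) = P k) → ∃ k, P k ∈ B := by
  let Xs : Set (ℕ → ℕ) := (fun k => (l k).1) '' Set.Iio m
  have hX : Xs.Finite := (Set.finite_Iio m).image _
  have hlj : ∀ j k, l (k + m * j) = l k := by
    intro j
    induction j with
    | zero => intro k; simp
    | succ j ih => intro k; rw [Nat.mul_succ, ← Nat.add_assoc, hl, ih]
  have hmem : ∀ k, (l k).1 ∈ Xs := by
    intro k
    refine ⟨k % m, Nat.mod_lt _ hm, ?_⟩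
    simp only
    conv_rhs => rw [← Nat.mod_add_div k m]
    rw [hlj]
  obtain ⟨B, hB, hA⟩ := lemA hX m hm
  let E : Set T := ⋃ x ∈ Xs, ⋃ y ∈ Xs, {p | x ≠ y ∧ ptr x p ≠ none ∧ ptr y p ≠ none}
  have hE : E.Finite := by
    refine hX.biUnion fun x _ => hX.biUnion fun y _ => ?_
    by_cases h : x = y
    · simp [h]
    · exact (E_finite h).subset fun p hp => hp.2
  refine ⟨E ∪ B, hE.union hB, fun P hP hper => ?_⟩
  by_contra hcon
  push Not at hcon
  have hPj : ∀ j k, P (k + m * j) = P k := by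
    intro j
    induction j with
    | zero => intro k; simp
    | succ j ih => intro k; rw [Nat.mul_succ, ← Nat.add_assoc, hper, ih]
  have hdu : ∀ k, ptr (l k).1 (P k) = some (P (k + 1), (l k).2) ∨
      ptr (l k).1 (P (k + 1)) = some (P k, !(l k).2) := by
    intro k
    rw [hP k]
    exact act_cases _ _ _
  have hup : ∀ k, ptr (l k).1 (P (k + 1)) = some (P k, !(l k).2) →
      ptr (l (k + 1)).1 (P (k + 1 + 1)) = some (P (k + 1), !(l (k + 1)).2) := by
    intro k hk
    rcases hdu (k + 1) with h | h
    · exfalso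
      by_cases hxy : (l k).1 = (l (k + 1)).1
      · have h2 := hred k hxy
        rw [← hxy, hk, ← h2] at h
        simp at h
      · refine hcon (k + 1) (Or.inl ?_)
        simp only [E, Set.mem_iUnion]
        refine ⟨_, hmem k, _, hmem (k + 1), hxy, ?_, ?_⟩
        · rw [hk]; simp
        · rw [h]; simp
    · exact h
  by_cases hall : ∀ k, ptr (l k).1 (P k) = some (P (k + 1), (l k).2)
  · obtain ⟨k, hk⟩ := hA P hper (fun k => ⟨_, hmem k, _, hall k⟩)
    exact hcon k (Or.inr hk)
  · push Not at hall
    obtain ⟨k0, hk0⟩ := hall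
    have hk0' := (hdu k0).resolve_left hk0
    have hge : ∀ j, ptr (l (k0 + j)).1 (P (k0 + j + 1)) = some (P (k0 + j), !(l (k0 + j)).2) := by
      intro j
      induction j with
      | zero => exact hk0'
      | succ j ih => exact hup _ ih
    have hall' : ∀ k, ptr (l k).1 (P (k + 1)) = some (P k, !(l k).2) := by
      intro k
      have h1 : k + m * k0 = k0 + (k + m * k0 - k0) := by
        have := Nat.le_mul_of_pos_left k0 hm
        omega
      have h2 := hge (k + m * k0 - k0)
      rw [← h1, hlj, hPj, show k + m * k0 + 1 = (k + 1) + m * k0 by omega, hPj] at h2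
      exact h2
    obtain ⟨k, hk⟩ := hA (fun k => P ((m - 1) * k)) (by
        intro k
        rw [Nat.mul_add, Nat.mul_comm (m - 1) m, hPj]) (by
        intro k
        refine ⟨_, hmem ((m - 1) * k + (m - 1)), !(l ((m - 1) * k + (m - 1))).2, ?_⟩
        have h1 := hall' ((m - 1) * k + (m - 1))
        rw [show (m - 1) * k + (m - 1) + 1 = (m - 1) * k + m by omega, hper] at h1
        rw [Nat.mul_add, Nat.mul_one]
        exact h1)
    exact hcon _ (Or.inr hk)

theorem act_injective (x : ℕ → ℕ) (e : Bool) : Function.Injective (act x e) := by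
  intro p q h
  have := congrArg (act x (!e)) h
  rwa [act_act, act_act] at this

theorem cyc_fin (L : List ((ℕ → ℕ) × Bool)) (hL : FreeGroup.IsCyclicallyReduced L) (hne : L ≠ []) :
    {p | run L p = p}.Finite := by
  have hm : 0 < L.length := List.length_pos_iff.2 hne
  obtain ⟨m, hmm⟩ : ∃ m, m = L.length := ⟨_, rfl⟩
  rw [← hmm] at hm
  let l : ℕ → (ℕ → ℕ) × Bool := fun k => L[m - 1 - k % m]'(by omega)
  have hl : ∀ k, l (k + m) = l k := by
    intro k; simp only [l, Nat.add_mod_right]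
  have hred : ∀ k, (l k).1 = (l (k + 1)).1 → (l k).2 = (l (k + 1)).2 := by
    intro k
    have hk := Nat.mod_lt k hm
    by_cases hk1 : k % m + 1 < m
    · have h1 : (k + 1) % m = k % m + 1 := by
        rw [Nat.add_mod]
        have : 1 % m = 1 := Nat.mod_eq_of_lt (by omega)
        rw [this, Nat.mod_eq_of_lt hk1]
      have h2 := List.isChain_iff_getElem.1 hL.1 (m - 1 - (k % m + 1)) (by omega)
      simp only [l, h1]
      have h3 : m - 1 - (k % m + 1) + 1 = m - 1 - k % m := by omega
      simp only [h3] at h2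
      intro h
      exact (h2 h.symm).symm
    · have h0 : k % m = m - 1 := by omega
      have h1 : (k + 1) % m = 0 := by
        rw [Nat.add_mod, h0]
        rcases Nat.lt_or_ge 1 m with h | h
        · rw [Nat.mod_eq_of_lt h, Nat.sub_add_cancel hm, Nat.mod_self]
        · have : m = 1 := by omega
          subst this; rfl
      have h2 := hL.2
      simp only [l, h1, h0, Nat.sub_self, Nat.sub_zero]
      intro h
      refine (h2 _ ?_ _ ?_ h.symm).symm
      · rw [List.getLast?_eq_getElem?]; simp [hmm]
      · rw [List.head?_eq_getElem?]; simp
  obtain ⟨B, hB, hc⟩ := cyc_core l m hm hl hred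
  let Q : ℕ → T → T := fun k => Nat.rec (fun p => p) (fun k r p => act (l k).1 (l k).2 (r p)) k
  have Qs : ∀ k p, Q (k + 1) p = act (l k).1 (l k).2 (Q k p) := fun k p => rfl
  have hinj : ∀ k, Function.Injective (Q k) := by
    intro k
    induction k with
    | zero => exact fun a b h => h
    | succ k ih => exact fun a b h => ih (act_injective _ _ h)
  have hrun : ∀ k, k ≤ m → ∀ p, Q k p = run (L.drop (m - k)) p := by
    intro k
    induction k with
    | zero => intro _ p; simp [hmm]; rfl
    | succ k ih =>
      intro hk p
      rw [Qs, ih (by omega)]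
      have h1 : L.drop (m - (k + 1)) = L[m - (k + 1)]'(by omega) :: L.drop (m - k) := by
        rw [List.drop_eq_getElem_cons (by omega)]
        congr 2
        omega
      have h2 : l k = L[m - (k + 1)]'(by omega) := by
        simp only [l]
        congr 1
        rw [Nat.mod_eq_of_lt (by omega)]
        omega
      rw [h1, run_cons, h2]
  have : (⋃ k ∈ Set.Iio m, Q k ⁻¹' B).Finite :=
    (Set.finite_Iio m).biUnion fun k _ => hB.preimage (hinj k).injOn
  refine this.subset fun p hp => ?_
  have hp : run L p = p := hp
  have hQm : Q m p = p := by rw [hrun m le_rfl]; simpa using hp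
  have hQp : ∀ k, Q (k + m) p = Q k p := by
    intro k
    induction k with
    | zero => rw [Nat.zero_add, hQm]; rfl
    | succ k ih =>
      rw [show k + 1 + m = (k + m) + 1 by omega, Qs, Qs, ih, hl]
  obtain ⟨k, hk⟩ := hc (fun k => Q k p) (fun k => Qs k p) hQp
  simp only [Set.mem_iUnion]
  refine ⟨k % m, Nat.mod_lt _ hm, ?_⟩
  have hj : ∀ j k, Q (k + m * j) p = Q k p := by
    intro j
    induction j with
    | zero => intro k; simp
    | succ j ih => intro k; rw [Nat.mul_succ, ← Nat.add_assoc, hQp, ih]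
  show Q (k % m) p ∈ B
  rw [← hj (k / m) (k % m), Nat.mod_add_div]
  exact hk

theorem fixed_finite (w : FreeGroup (ℕ → ℕ)) (hw : w ≠ 1) : {p | phi w p = p}.Finite := by
  let L := w.toWord
  have hr : FreeGroup.IsReduced L := FreeGroup.isReduced_toWord
  have hc := FreeGroup.reduceCyclically.isCyclicallyReduced hr
  have hconj := FreeGroup.reduceCyclically.conj_conjugator_reduceCyclically L
  set C := FreeGroup.reduceCyclically.conjugator L
  set R := FreeGroup.reduceCyclically L
  have hwe : w = FreeGroup.mk C * FreeGroup.mk R * (FreeGroup.mk C)⁻¹ := by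
    rw [FreeGroup.inv_mk, FreeGroup.mul_mk, FreeGroup.mul_mk, hconj, FreeGroup.mk_toWord]
  have hR : R ≠ [] := by
    intro h
    apply hw
    rw [hwe, h, ← FreeGroup.one_eq_mk]
    group
  have hf := cyc_fin R hc hR
  refine (hf.image (phi (FreeGroup.mk C))).subset ?_
  intro p hp
  have hp : phi w p = p := hp
  refine ⟨(phi (FreeGroup.mk C))⁻¹ p, ?_, by simp⟩
  show run R _ = _
  rw [← phi_mk]
  rw [hwe, map_mul, map_mul, map_inv, Equiv.Perm.mul_apply, Equiv.Perm.mul_apply] at hp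
  rw [Equiv.Perm.eq_inv_iff_eq]
  exact hp

theorem phi_injective : Function.Injective phi := by
  rw [injective_iff_map_eq_one]
  intro w hw
  by_contra h
  have := fixed_finite w h
  rw [hw] at this
  simp only [Equiv.Perm.one_apply] at this
  exact Set.infinite_univ (by simpa using this)

end
end MCG

namespace MCG
open Classical

noncomputable section

theorem lemE (C : ℕ → T) (N : ℕ → ℕ)
    (hV : ∀ i, Vis (fun y => ptrU (UN (Kf (N i)) (N i) y) y) (C i) (C (i + 1)))
    (hN : ∀ i, code (C i) ≤ N i) : ∃ L, ∀ i, run L (root (C i)) = C i := by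
  generalize h0 : C 0 = c
  induction c generalizing C with
  | src n j =>
    have : ∀ i, ∃ n j, C i = T.src n j := by
      intro i
      induction i with
      | zero => exact ⟨n, j, h0⟩
      | succ i ih =>
        obtain ⟨n, j, h⟩ := ih
        have h1 := hV i
        rw [h] at h1
        cases hc : C (i + 1) with
        | src n j => exact ⟨n, j, rfl⟩
        | q n j => rw [hc] at h1; simp [Vis] at h1
        | child p a s e => rw [hc] at h1; simp [Vis] at h1
    refine ⟨[], fun i => ?_⟩
    obtain ⟨n, j, h⟩ := this i
    rw [h]; rfl
  | q n j =>
    have h1 := hV 0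
    rw [h0] at h1
    cases hc : C (0 + 1) <;> rw [hc] at h1 <;> simp [Vis] at h1
  | child p0 a s0 e ih =>
    have : ∀ i, ∃ p s, C i = T.child p a s e := by
      intro i
      induction i with
      | zero => exact ⟨p0, s0, h0⟩
      | succ i ih =>
        obtain ⟨n, j, h⟩ := ih
        have h1 := hV i
        rw [h] at h1
        cases hc : C (i + 1) with
        | src n j => rw [hc] at h1; simp [Vis] at h1
        | q n j => rw [hc] at h1; simp [Vis] at h1
        | child p a s e =>
          rw [hc] at h1
          obtain ⟨rfl, rfl, _⟩ := h1
          exact ⟨p, s, rfl⟩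
    choose p s hps using this
    have hV' : ∀ i, (s i).length < (s (i + 1)).length ∧
        (∃ y, par y = a ∧ s (i + 1) = pre y (s (i + 1)).length) ∧
        (∀ y, par y = a → s (i + 1) = pre y (s (i + 1)).length →
          ptr y (C i) = some (p i, !e)) ∧
        Vis (fun y => ptrU (UN (Kf (N i)) (N i) y) y) (p i) (p (i + 1)) := by
      intro i
      have h1 := hV i
      rw [hps i, hps (i + 1)] at h1
      obtain ⟨_, _, h3, h4, h5, h6⟩ := h1
      refine ⟨h3, h4, fun y hy hy' => ?_, h6⟩
      have h7 := h5 y hy hy'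
      simp only at h7
      rw [← hps i, trunc (hN i)] at h7
      exact h7
    obtain ⟨L, hL⟩ := ih p (fun i => (hV' i).2.2.2) (fun i => by
      have := hN i
      rw [hps i] at this
      have h2 := code_child (p i) a (s i) e
      omega) (by
      have := (hps 0).symm.trans h0
      simp only [T.child.injEq] at this
      exact this.1)
    choose y hya hys using fun i => (hV' i).2.1
    have hlen : ∀ i, i ≤ (s i).length := by
      intro i
      induction i with
      | zero => omega
      | succ i ih => have := (hV' i).1; omega
    have hmono : ∀ i, ∀ k < (s (i + 1)).length, y (i + 1) k = y i k := by
      intro i k hk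
      have h1 := (hV' (i + 1)).2.2.1 (y (i + 1)) (hya _) (hys _)
      rw [hps (i + 1), ptr_child] at h1
      split_ifs at h1 with h2
      have h3 : s (i + 1) = pre (y (i + 1)) (s (i + 1)).length := by
        conv_lhs => rw [h2.2.1]
        conv_rhs => rw [h2.2.1]
        exact lam_eq_pre _ _
      exact pre_eq_iff.1 (h3.symm.trans (hys i)) k hk
    have hle : ∀ i d, (s (i + 1)).length ≤ (s (i + d + 1)).length := by
      intro i d
      induction d with
      | zero => exact le_rfl
      | succ d ih =>
        have h1 := (hV' (i + d + 1)).1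
        have h2 : i + (d + 1) + 1 = i + d + 1 + 1 := by omega
        rw [h2]; omega
    have hmono2 : ∀ d i, ∀ k < (s (i + 1)).length, y (i + d) k = y i k := by
      intro d
      induction d with
      | zero => intro i k _; rfl
      | succ d ih =>
        intro i k hk
        rw [← ih i k hk]
        exact hmono (i + d) k (lt_of_lt_of_le hk (hle i d))
    let z : ℕ → ℕ := fun k => y k k
    have hz : ∀ i, ∀ k < (s (i + 1)).length, y i k = z k := by
      intro i k hk
      rw [← hmono2 k i k hk, Nat.add_comm]
      exact hmono2 i k k (by have := hlen (k + 1); omega)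
    have hpz : par z = a := by
      rw [← hya 0]; rfl
    refine ⟨(z, e) :: L, fun i => ?_⟩
    have h1 := (hV' i).2.2.1 z hpz ((hys i).trans (pre_congr (hz i)))
    have h2 := ptr_back h1
    rw [Bool.not_not] at h2
    have h3 : root (C i) = root (p i) := by rw [hps i]; rfl
    rw [run_cons, h3, hL i]
    exact h2

theorem inf_fiber {α : Type} {A : Set ℕ} (hA : A.Infinite) (c : ℕ → α) (hc : (c '' A).Finite) :
    ∃ v, {n | n ∈ A ∧ c n = v}.Infinite := by
  by_contra h
  push Not at h
  refine hA ((hc.biUnion fun v _ => h v).subset ?_)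
  intro n hn
  simp only [Set.mem_iUnion]
  exact ⟨c n, ⟨n, hn, rfl⟩, hn, rfl⟩

theorem konig {A : Set ℕ} (hA : A.Infinite) (R : ℕ → ℕ → Prop) (K : ℕ → ℕ)
    (hfin : ∀ r, {n | n ∈ A ∧ K n = r}.Finite)
    (hpred : ∀ n ∈ A, ∀ r, K n = r + 1 → ∃ m ∈ A, R m n ∧ K m = r) :
    ∃ a : ℕ → ℕ, ∀ i, a i ∈ A ∧ R (a i) (a (i + 1)) := by
  let R' : ℕ → ℕ → Prop := fun m n => m ∈ A ∧ n ∈ A ∧ R m n ∧ K n = K m + 1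
  let D : ℕ → Set ℕ := fun n => {m | Relation.ReflTransGen R' n m}
  have hroot : ∀ r, ∀ n ∈ A, K n = r → ∃ m ∈ A, K m = 0 ∧ n ∈ D m := by
    intro r
    induction r with
    | zero => intro n hn hk; exact ⟨n, hn, hk, Relation.ReflTransGen.refl⟩
    | succ r ih =>
      intro n hn hk
      obtain ⟨m, hm, hR, hkm⟩ := hpred n hn r hk
      obtain ⟨m', h1, h2, h3⟩ := ih m hm hkm
      exact ⟨m', h1, h2, Relation.ReflTransGen.tail h3 ⟨hm, hn, hR, by omega⟩⟩
  have hstart : ∃ n ∈ A, (D n).Infinite := by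
    by_contra h
    push Not at h
    refine hA (((hfin 0).biUnion fun m hm => h m hm.1).subset ?_)
    intro n hn
    obtain ⟨m, h1, h2, h3⟩ := hroot _ n hn rfl
    simp only [Set.mem_iUnion]
    exact ⟨m, ⟨h1, h2⟩, h3⟩
  have hnext : ∀ n : {n // n ∈ A ∧ (D n).Infinite}, ∃ n' : {n // n ∈ A ∧ (D n).Infinite},
      R n.1 n'.1 := by
    rintro ⟨n, hn, hD⟩
    by_contra h
    push Not at h
    have h1 : ∀ m, R' n m → (D m).Finite := by
      intro m hm
      by_contra hc
      exact h ⟨m, hm.2.1, hc⟩ hm.2.2.1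
    have h2 : {m | R' n m}.Finite := (hfin (K n + 1)).subset fun m hm => ⟨hm.2.1, hm.2.2.2⟩
    refine hD (((Set.finite_singleton n).union (h2.biUnion fun m hm => h1 m hm)).subset ?_)
    intro m hm
    rcases Relation.ReflTransGen.cases_head hm with h3 | ⟨c, h3, h4⟩
    · left; exact h3.symm
    · right
      simp only [Set.mem_iUnion]
      exact ⟨c, h3, h4⟩
  choose nx hnx using hnext
  obtain ⟨n0, hn0⟩ := hstart
  let b : ℕ → {n // n ∈ A ∧ (D n).Infinite} := fun i => Nat.rec ⟨n0, hn0⟩ (fun _ r => nx r) i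
  exact ⟨fun i => (b i).1, fun i => ⟨(b i).2.1, hnx (b i)⟩⟩

theorem bitv_le (c : T) : bitv c ≤ 1 := by
  unfold bitv
  split <;> omega

theorem catch_perm (h : Equiv.Perm T) : ∃ L, {t | run L t = h t}.Infinite := by
  let f : ℕ → ℕ := fun k => eqv (h (eqv.symm k))
  have hf : ∀ t, fT f t = h t := by intro t; simp [fT, f]
  have hcc : ∀ n, cc f n = h (T.src n (cidx f n)) := fun n => hf _
  have hok : ∀ n, site f n → ok f n := by
    intro n hn
    refine ⟨hn, ?_, ?_⟩
    · have hne : {i | i ≤ (V n).ncard ∧ fT f (T.src n i) ∉ V n}.Nonempty := by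
        by_contra hc
        rw [Set.not_nonempty_iff_eq_empty] at hc
        have h1 : ∀ i ≤ (V n).ncard, fT f (T.src n i) ∈ V n := by
          intro i hi
          by_contra h2
          have : i ∈ {i | i ≤ (V n).ncard ∧ fT f (T.src n i) ∉ V n} := ⟨hi, h2⟩
          rw [hc] at this
          exact this
        have h2 : ((fun i => fT f (T.src n i)) '' Set.Iic (V n).ncard) ⊆ V n := by
          rintro _ ⟨i, hi, rfl⟩
          exact h1 i hi
        have h3 := Set.ncard_le_ncard h2 (V_finite n)
        rw [Set.ncard_image_of_injective] at h3
        · rw [← Finset.coe_Iic, Set.ncard_coe_finset, Nat.card_Iic] at h3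
          omega
        · intro i j hij
          simp only [hf] at hij
          have := h.injective hij
          simpa using this
      exact (Nat.sInf_mem hne).2
    · intro m hm _ he
      rw [hcc, hcc] at he
      have := h.injective he
      simp only [T.src.injEq] at this
      omega
  have hA : {n | ok f n}.Infinite := by
    have : Function.Injective (fun m => Encodable.encode (pre f m)) := by
      intro m m' he
      have := Encodable.encode_injective he
      have := congrArg List.length this
      simpa using this
    refine (Set.infinite_range_of_injective this).mono ?_
    rintro _ ⟨m, rfl⟩
    apply hok
    unfold site S
    simp
  have hcatch : ∀ (L : List ((ℕ → ℕ) × Bool)) (B : Set ℕ), B.Infinite →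
      (∀ n ∈ B, run L (T.src n (cidx f n)) = cc f n) → {t | run L t = h t}.Infinite := by
    intro L B hB hr
    have hinj : Set.InjOn (fun n => T.src n (cidx f n)) B := by
      intro a _ b _ hab
      simp only [T.src.injEq] at hab
      exact hab.1
    refine (hB.image hinj).mono ?_
    rintro _ ⟨n, hn, rfl⟩
    show run L _ = _
    rw [hr n hn, hcc]
  have hk : ∃ k, {n | n ∈ {n | ok f n} ∧ kind f n = k}.Infinite := by
    by_contra hc
    push Not at hc
    have hc0 := hc 0
    have : (kind f '' {n | ok f n}).Finite := by
      refine ((hc0.image (fun m => match qidx (cc f m) with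
        | none => 0
        | some j => j + 1)).insert 0).subset ?_
      rintro _ ⟨n, hn, rfl⟩
      by_cases hex : ∃ m < n, ok f m ∧ qidx (cc f m) = qidx (cc f n)
      · right
        have hex' : ∃ m, ok f m ∧ qidx (cc f m) = qidx (cc f n) := by
          obtain ⟨m, _, h1⟩ := hex
          exact ⟨m, h1⟩
        refine ⟨Nat.find hex', ⟨(Nat.find_spec hex').1, ?_⟩, ?_⟩
        · unfold kind
          rw [if_neg]
          rintro ⟨m, hm, h1, h2⟩
          exact Nat.find_min hex' hm ⟨h1, h2.trans (Nat.find_spec hex').2⟩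
        · unfold kind
          rw [if_pos hex]
          simp only [(Nat.find_spec hex').2]
          all_goals (cases qidx (cc f n) <;> rfl)
      · left
        unfold kind
        rw [if_neg hex]
    obtain ⟨v, hv⟩ := inf_fiber hA (kind f) this
    exact hv (hc v)
  obtain ⟨k, hk⟩ := hk
  obtain ⟨b, hb⟩ := inf_fiber hk (fun n => bitv (cc f n))
    ((Set.finite_Iic 1).subset (by rintro _ ⟨n, _, rfl⟩; exact bitv_le _))
  set A := {n | n ∈ {n | n ∈ {n | ok f n} ∧ kind f n = k} ∧ bitv (cc f n) = b} with hAdef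
  by_cases hr : ∃ r, {n | n ∈ A ∧ K n f = r}.Infinite
  · obtain ⟨r, hr⟩ := hr
    let x : ℕ → ℕ := fun i => match i with
      | 0 => b
      | 1 => k
      | 2 => r
      | i + 3 => f i
    have htl : tl x = f := rfl
    refine ⟨[(x, true)], hcatch _ _ hr ?_⟩
    rintro n ⟨⟨⟨h1, h2⟩, h3⟩, h4⟩
    have hu : used x n := ⟨h1, h3.symm, h2.symm, h4.symm⟩
    exact act_down (ptr_used hu)
  · push Not at hr
    obtain ⟨a, ha⟩ := konig hb (fun m n => Rel (Kf n) n f m) (fun n => K n f) hr (by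
      rintro n ⟨⟨h1, h2⟩, h3⟩ r hK
      obtain ⟨m, hm, hm'⟩ := K_pred hK
      refine ⟨m, ⟨⟨hm.2.1, ?_⟩, ?_⟩, hm, hm'⟩
      · rw [hm.2.2.2.2.1, h2]
      · show bitv (cc f m) = b
        rw [hm.2.2.2.1]; exact h3)
    obtain ⟨L, hL⟩ := lemE (fun i => cc f (a i)) (fun i => a (i + 1))
      (fun i => (ha i).2.2.2.2.2.2.2.2.2) (fun i => (ha i).2.2.2.2.2.2.1)
    have hmono : StrictMono a := strictMono_nat_of_lt_succ fun i => (ha i).2.1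
    refine ⟨L, hcatch L (Set.range a) (Set.infinite_range_of_injective hmono.injective) ?_⟩
    rintro _ ⟨i, rfl⟩
    have h1 := hL i
    rw [(ha i).2.2.2.2.2.2.2.1] at h1
    exact h1

end
end MCG

namespace MCG
open Classical

noncomputable section

theorem used_q_unique {x : ℕ → ℕ} {j n n' : ℕ} (hx : x 1 ≠ j + 1) (h : used x n) (h' : used x n')
    (hq : qidx (cc (tl x) n) = some j) (hq' : qidx (cc (tl x) n') = some j) : n = n' := by
  have key : ∀ n n', used x n → used x n' → qidx (cc (tl x) n) = some j →
      qidx (cc (tl x) n') = some j → ¬ n < n' := by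
    intro n n' h h' hq hq' hl
    have h1 := h'.2.2.1
    unfold kind at h1
    rw [if_pos ⟨n, hl, h.1, hq.trans hq'.symm⟩, hq'] at h1
    exact hx h1
  have h1 := key n n' h h' hq hq'
  have h2 := key n' n h' h hq' hq
  omega

def Adj (N : ℕ) (a b : (ℕ → ℕ) × Bool) : Prop := a.2 ≠ b.2 → pre a.1 N ≠ pre b.1 N

theorem run_up {N j r : ℕ} (hr : N ≤ r) (L : List ((ℕ → ℕ) × Bool)) (hch : L.IsChain (Adj N))
    (hfree : ∀ l ∈ L, ∀ n, used l.1 n → root (cc (tl l.1) n) ≠ T.q j r) :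
    root (run L (T.q j r)) = T.q j r ∧
    ∀ l L', L = l :: L' → run L (T.q j r) =
      T.child (run L' (T.q j r)) (par l.1) (lam l.1 (run L' (T.q j r))) l.2 := by
  induction L with
  | nil => exact ⟨rfl, fun l L' h => by simp at h⟩
  | cons l L ih =>
    have hch' : L.IsChain (Adj N) := hch.tail
    obtain ⟨ih1, ih2⟩ := ih hch' (fun l' hl' => hfree l' (List.mem_cons_of_mem _ hl'))
    have h1 : run (l :: L) (T.q j r) =
        T.child (run L (T.q j r)) (par l.1) (lam l.1 (run L (T.q j r))) l.2 := by
      rw [run_cons]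
      apply act_child
      · intro t ht
        cases L with
        | nil => rw [run_nil, ptr_q] at ht; simp at ht
        | cons l' L' =>
          have h2 := ih2 l' L' rfl
          have hroot : root (run L' (T.q j r)) = T.q j r := by
            rw [h2] at ih1; exact ih1
          rw [h2, ptr_child] at ht
          split_ifs at ht with h3
          simp only [Option.some.injEq, Prod.mk.injEq] at ht
          have hadj : Adj N l l' := (List.isChain_cons_cons.1 hch).1
          have hq : (qidx (run L' (T.q j r))).isSome := by
            rw [← qidx_root, hroot]; rfl
          have h4 := h3.2.1
          rw [lam_q hq, lam_q hq] at h4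
          refine hadj ?_ ?_
          · rw [← ht.2]; simp
          · refine pre_congr fun k hk => (pre_eq_iff.1 h4 k ?_).symm
            have h5 := code_root_le (run L' (T.q j r))
            rw [hroot] at h5
            have h6 := le_code_q j r
            omega
      · rintro ⟨_, n, hn, hc⟩
        refine hfree l (by simp) n hn ?_
        rw [hc, ih1]
    refine ⟨?_, ?_⟩
    · rw [h1]; exact ih1
    · intro l0 L0 h0
      simp only [List.cons.injEq] at h0
      obtain ⟨rfl, rfl⟩ := h0
      exact h1

def lab : T → ℕ
  | T.src _ _ => 0
  | T.q _ _ => 0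
  | T.child p _ s _ => lab p + s.sum

theorem run_lab {N j r : ℕ} (hr : N ≤ r) (L : List ((ℕ → ℕ) × Bool)) (hch : L.IsChain (Adj N))
    (hfree : ∀ l ∈ L, ∀ n, used l.1 n → root (cc (tl l.1) n) ≠ T.q j r) :
    ∀ l ∈ L, ∀ k < r, l.1 k ≤ lab (run L (T.q j r)) := by
  induction L with
  | nil => intro l hl; simp at hl
  | cons l L ih =>
    have hch' : L.IsChain (Adj N) := hch.tail
    have hfree' : ∀ l ∈ L, ∀ n, used l.1 n → root (cc (tl l.1) n) ≠ T.q j r :=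
      fun l' hl' => hfree l' (List.mem_cons_of_mem _ hl')
    have h0 := run_up hr L hch' hfree'
    have h1 := (run_up hr (l :: L) hch hfree).2 l L rfl
    intro l' hl' k hk
    rw [h1, lab]
    rcases List.mem_cons.1 hl' with rfl | hl'
    · have hq : (qidx (run L (T.q j r))).isSome := by
        rw [← qidx_root, h0.1]; rfl
      rw [lam_q hq]
      have h5 := code_root_le (run L (T.q j r))
      rw [h0.1] at h5
      have h6 := le_code_q j r
      have h7 : l'.1 k ∈ pre l'.1 (code (run L (T.q j r))) := by
        unfold pre
        exact List.mem_map.2 ⟨k, List.mem_range.2 (by omega), rfl⟩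
      have := List.le_sum_of_mem h7
      omega
    · have := ih hch' hfree' l' hl' k hk
      omega

theorem run_dep (L : List ((ℕ → ℕ) × Bool)) (p : T) :
    ∃ M, ∀ L', List.Forall₂ (fun a b : (ℕ → ℕ) × Bool => (∀ k < M, a.1 k = b.1 k) ∧ a.2 = b.2) L L' →
      run L p = run L' p := by
  induction L with
  | nil =>
    refine ⟨0, fun L' h => ?_⟩
    cases h
    rfl
  | cons l L ih =>
    obtain ⟨M0, h0⟩ := ih
    obtain ⟨M1, h1⟩ := dep_act l.2 (run L p)
    refine ⟨max M0 M1, fun L' h => ?_⟩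
    cases h with
    | cons ha hb =>
      rename_i l' L'
      rw [run_cons, run_cons]
      have h2 := h0 L' (hb.imp fun a b hab => ⟨fun k hk => hab.1 k (lt_of_lt_of_le hk (le_max_left _ _)), hab.2⟩)
      rw [← h2, ← ha.2]
      exact h1 _ _ fun k hk => ha.1 k (lt_of_lt_of_le hk (le_max_right _ _))

/-- The word given by signs and letters. -/
def wrd {m : ℕ} (ε : Fin m → Bool) (x : Fin m → ℕ → ℕ) : List ((ℕ → ℕ) × Bool) :=
  List.ofFn (fun l => (x l, ε l))

def Good {m : ℕ} (ε : Fin m → Bool) (N j : ℕ) (x : Fin m → ℕ → ℕ) : Prop :=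
  (∀ l l' : Fin m, l'.1 = l.1 + 1 → ε l ≠ ε l' → pre (x l) N ≠ pre (x l') N) ∧ ∀ l, x l 1 ≠ j + 1

def piece {m : ℕ} (ε : Fin m → Bool) (N j : ℕ) : Set (ℕ → ℕ) :=
  {φ | ∃ x, Good ε N j x ∧ ∀ p, eqv.symm (φ (eqv p)) = run (wrd ε x) p}

theorem Good.chain {m : ℕ} {ε : Fin m → Bool} {N j : ℕ} {x : Fin m → ℕ → ℕ} (h : Good ε N j x) :
    (wrd ε x).IsChain (Adj N) := by
  rw [List.isChain_iff_getElem]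
  intro i hi
  simp only [wrd, List.getElem_ofFn]
  simp only [wrd, List.length_ofFn] at hi
  exact h.1 ⟨i, by omega⟩ ⟨i + 1, hi⟩ rfl

theorem Good.bound {m : ℕ} {ε : Fin m → Bool} {N j : ℕ} {x : Fin m → ℕ → ℕ} (h : Good ε N j x)
    (r : ℕ) (hr : N ≤ r) : ∃ r' ∈ Finset.Icc r (r + m), ∀ l, ∀ k < r,
      x l k ≤ lab (run (wrd ε x) (T.q j r')) := by
  have hc : ∀ l : Fin m, ∃ c, ∀ r' n, used (x l) n → root (cc (tl (x l)) n) = T.q j r' → r' = c := by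
    intro l
    by_cases hex : ∃ c n, used (x l) n ∧ root (cc (tl (x l)) n) = T.q j c
    · obtain ⟨c, n, hn, hcn⟩ := hex
      refine ⟨c, fun r' n' hn' hr' => ?_⟩
      have h1 : n = n' := used_q_unique (h.2 l) hn hn'
        (by rw [← qidx_root, hcn]; rfl) (by rw [← qidx_root, hr']; rfl)
      subst h1
      rw [hcn] at hr'
      simp only [T.q.injEq] at hr'
      exact hr'.2.symm
    · refine ⟨0, fun r' n' hn' hr' => absurd ⟨r', n', hn', hr'⟩ hex⟩
  choose c hc using hc
  obtain ⟨r', h1, h2⟩ := Finset.exists_mem_notMem_of_card_lt_card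
    (s := Finset.univ.image c) (t := Finset.Icc r (r + m)) (by
      have := Finset.card_image_le (s := Finset.univ) (f := c)
      simp only [Finset.card_univ, Fintype.card_fin] at this
      simp only [Nat.card_Icc]
      omega)
  refine ⟨r', h1, fun l k hk => ?_⟩
  have hr' := (Finset.mem_Icc.1 h1).1
  refine run_lab (N := N) (by omega) (wrd ε x) h.chain ?_ (x l, ε l) ?_ k (by omega)
  · intro l hl n hn hroot
    simp only [wrd, List.mem_ofFn] at hl
    obtain ⟨i, rfl⟩ := hl
    apply h2
    rw [Finset.mem_image]
    exact ⟨i, Finset.mem_univ _, (hc i r' n hn hroot).symm⟩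
  · simp only [wrd, List.mem_ofFn]
    exact ⟨l, rfl⟩

open Filter Topology in
theorem piece_closed {m : ℕ} (ε : Fin m → Bool) (N j : ℕ) : IsClosed (piece ε N j) := by
  apply IsSeqClosed.isClosed
  intro φs φ hφs hlim
  choose x hgood hrun using hφs
  have hev : ∀ k, ∀ᶠ i in atTop, φs i k = φ k := by
    intro k
    have := (tendsto_pi_nhds.1 hlim) k
    rw [nhds_discrete] at this
    exact tendsto_pure.1 this
  have hb : ∀ k, ∃ b, ∀ i l, x i l k ≤ b := by
    intro k
    let r := max N (k + 1)
    have hfin : ∀ᶠ i in atTop, ∀ r' ∈ Finset.Icc r (r + m), φs i (eqv (T.q j r')) = φ (eqv (T.q j r')) := by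
      rw [Filter.eventually_all_finset]
      exact fun r' _ => hev _
    obtain ⟨i0, hi0⟩ := eventually_atTop.1 hfin
    let b1 := ∑ r' ∈ Finset.Icc r (r + m), lab (eqv.symm (φ (eqv (T.q j r'))))
    let b2 := ∑ i ∈ Finset.range i0, ∑ l, x i l k
    refine ⟨b1 + b2, fun i l => ?_⟩
    rcases Nat.lt_or_ge i i0 with hi | hi
    · have h1 : x i l k ≤ ∑ l, x i l k :=
        Finset.single_le_sum (f := fun l => x i l k) (fun _ _ => Nat.zero_le _) (Finset.mem_univ l)
      have h2 : ∑ l, x i l k ≤ b2 :=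
        Finset.single_le_sum (f := fun i => ∑ l, x i l k) (fun _ _ => Nat.zero_le _)
          (Finset.mem_range.2 hi)
      omega
    · obtain ⟨r', hr', hbd⟩ := (hgood i).bound r (le_max_left _ _)
      have h1 := hbd l k (lt_of_lt_of_le (Nat.lt_succ_self k) (le_max_right _ _))
      rw [← hrun i, hi0 i hi r' hr'] at h1
      have h2 : lab (eqv.symm (φ (eqv (T.q j r')))) ≤ b1 :=
        Finset.single_le_sum (f := fun r' => lab (eqv.symm (φ (eqv (T.q j r')))))
          (fun _ _ => Nat.zero_le _) hr'
      omega
  choose b hb using hb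
  have hcomp : IsCompact (Set.univ.pi (fun _ : Fin m => Set.univ.pi (fun k => Set.Iic (b k)))) :=
    isCompact_univ_pi fun _ => isCompact_univ_pi fun k => (Set.finite_Iic _).isCompact
  obtain ⟨z, _, σ, hσ, hz⟩ := hcomp.tendsto_subseq (x := x) (by
    intro i l _ k _
    exact hb k i l)
  have hzk : ∀ M, ∀ᶠ i in atTop, ∀ l, ∀ k < M, x (σ i) l k = z l k := by
    intro M
    rw [Filter.eventually_all]
    intro l
    have h1 : ∀ᶠ i in atTop, ∀ k ∈ Finset.range M, x (σ i) l k = z l k := by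
      rw [Filter.eventually_all_finset]
      intro k _
      have := (tendsto_pi_nhds.1 ((tendsto_pi_nhds.1 hz) l)) k
      rw [nhds_discrete] at this
      exact tendsto_pure.1 this
    filter_upwards [h1] with i hi k hk
    exact hi k (Finset.mem_range.2 hk)
  refine ⟨z, ?_, ?_⟩
  · obtain ⟨i, hi⟩ := (hzk (max N 2)).exists
    have hg := hgood (σ i)
    refine ⟨fun l l' hl hε he => hg.1 l l' hl hε ?_, fun l => ?_⟩
    · have e : ∀ l, pre (x (σ i) l) N = pre (z l) N := fun l =>
        pre_congr fun k hk => hi l k (lt_of_lt_of_le hk (le_max_left _ _))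
      rw [e, e, he]
    · rw [← hi l 1 (lt_of_lt_of_le one_lt_two (le_max_right _ _))]
      exact hg.2 l
  · intro p
    obtain ⟨M, hM⟩ := run_dep (wrd ε z) p
    obtain ⟨i, hi, hi'⟩ := ((hzk M).and (hσ.tendsto_atTop.eventually (hev (eqv p)))).exists
    rw [← hi', hrun]
    symm
    apply hM
    rw [List.forall₂_iff_get]
    refine ⟨by simp [wrd], fun i' h1 h2 => ?_⟩
    simp only [wrd, List.get_eq_getElem, List.getElem_ofFn]
    exact ⟨fun k hk => (hi _ k hk).symm, trivial⟩

end
end MCG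

namespace MCG
open Classical

noncomputable section

def psi : FreeGroup (ℕ → ℕ) →* Equiv.Perm ℕ :=
  (eqv.permCongrHom : Equiv.Perm T ≃* Equiv.Perm ℕ).toMonoidHom.comp phi

theorem psi_apply (w : FreeGroup (ℕ → ℕ)) (k : ℕ) : psi w k = eqv (phi w (eqv.symm k)) := rfl

theorem psi_injective : Function.Injective psi := by
  intro a b h
  exact phi_injective (eqv.permCongrHom.injective h)

def gN (x : ℕ → ℕ) : Equiv.Perm ℕ := psi (FreeGroup.of x)

theorem gN_injective : Function.Injective gN := fun a b h =>
  FreeGroup.of_injective (psi_injective h)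

theorem psi_lift : psi = FreeGroup.lift gN := by
  apply FreeGroup.ext_hom
  intro a
  rw [FreeGroup.lift_apply_of]
  rfl

theorem closure_eq : Subgroup.closure (Set.range gN) = psi.range := by
  rw [psi_lift, FreeGroup.range_lift_eq_closure]

theorem free_gen : FreelyGenerates (Set.range gN) := by
  let e : (ℕ → ℕ) ≃ Set.range gN := Equiv.ofInjective gN gN_injective
  let φ0 : FreeGroup (Set.range gN) →* Equiv.Perm ℕ := FreeGroup.lift Subtype.val
  have h1 : φ0 = psi.comp (FreeGroup.freeGroupCongr e.symm).toMonoidHom := by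
    apply FreeGroup.ext_hom
    rintro ⟨_, x, rfl⟩
    have : e.symm ⟨gN x, x, rfl⟩ = x := by
      rw [Equiv.symm_apply_eq]; rfl
    have h2 : φ0 (FreeGroup.of ⟨gN x, x, rfl⟩) = gN x := FreeGroup.lift_apply_of
    rw [h2]
    show gN x = psi (FreeGroup.freeGroupCongr e.symm (FreeGroup.of ⟨gN x, x, rfl⟩))
    rw [FreeGroup.freeGroupCongr_apply, FreeGroup.map.of, this]
    rfl
  have hinj : Function.Injective φ0 := by
    rw [h1]
    exact psi_injective.comp (FreeGroup.freeGroupCongr e.symm).injective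
  have hr : φ0.range = Subgroup.closure (Set.range gN) := by
    rw [FreeGroup.range_lift_eq_closure, Subtype.range_coe]
  refine ⟨(MonoidHom.ofInjective hinj).trans (MulEquiv.subgroupCongr hr), fun x => ?_⟩
  show φ0 (FreeGroup.of x) = _
  exact FreeGroup.lift_apply_of

theorem cofin : IsCofinitary (Subgroup.closure (Set.range gN)) := by
  rw [closure_eq]
  rintro _ ⟨w, rfl⟩ hw
  have hw' : w ≠ 1 := by rintro rfl; exact hw (map_one _)
  refine ((fixed_finite w hw').image eqv).subset ?_
  intro k hk
  have hk : psi w k = k := hk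
  refine ⟨eqv.symm k, ?_, by simp⟩
  show phi w _ = _
  rw [psi_apply] at hk
  rw [Equiv.eq_symm_apply]; exact hk

theorem maxim : IsMaximalCofinitary (Subgroup.closure (Set.range gN)) := by
  refine ⟨cofin, fun H hH hle => le_antisymm hle fun h hh => ?_⟩
  obtain ⟨L, hL⟩ := catch_perm (eqv.symm.permCongr h)
  have hm : psi (FreeGroup.mk L) ∈ Subgroup.closure (Set.range gN) := by
    rw [closure_eq]; exact ⟨_, rfl⟩
  have h1 : (psi (FreeGroup.mk L))⁻¹ * h = 1 := by
    by_contra hne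
    have h2 := hH _ (H.mul_mem (H.inv_mem (hle hm)) hh) hne
    refine (hL.image eqv.injective.injOn) (h2.subset ?_)
    rintro _ ⟨t, ht, rfl⟩
    have ht : run L t = eqv.symm.permCongr h t := ht
    show ((psi (FreeGroup.mk L))⁻¹ * h) (eqv t) = eqv t
    rw [Equiv.Perm.mul_apply, Equiv.Perm.inv_eq_iff_eq, psi_apply, Equiv.symm_apply_apply, phi_mk,
      ht]
    simp [Equiv.permCongr_apply]
  rw [inv_mul_eq_one] at h1
  rw [← h1]; exact hm

theorem piece_sub {m : ℕ} (ε : Fin m → Bool) (N j : ℕ) : piece ε N j ⊆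
    (fun g : Equiv.Perm ℕ => (g : ℕ → ℕ)) ''
        ((Subgroup.closure (Set.range gN) : Subgroup (Equiv.Perm ℕ)) : Set (Equiv.Perm ℕ)) := by
  rintro φ ⟨x, _, hx⟩
  refine ⟨psi (FreeGroup.mk (wrd ε x)), ?_, ?_⟩
  · rw [closure_eq]; exact ⟨_, rfl⟩
  · funext k
    show psi _ k = _
    rw [psi_apply, phi_mk, ← hx]
    simp

theorem mem_piece (w : FreeGroup (ℕ → ℕ)) : ∃ (m : ℕ) (ε : Fin m → Bool) (N j : ℕ),
    (psi w : ℕ → ℕ) ∈ piece ε N j := by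
  let L := w.toWord
  have hr : FreeGroup.IsReduced L := FreeGroup.isReduced_toWord
  let x : Fin L.length → ℕ → ℕ := fun l => L[l].1
  let ε : Fin L.length → Bool := fun l => L[l].2
  have hd : ∀ l l' : Fin L.length, ∃ k, x l ≠ x l' → x l k ≠ x l' k := by
    intro l l'
    by_cases h : x l = x l'
    · exact ⟨0, fun h' => absurd h h'⟩
    · obtain ⟨k, hk⟩ := Function.ne_iff.1 h
      exact ⟨k, fun _ => hk⟩
  choose d hd using hd
  have hw : wrd ε x = L := by
    unfold wrd
    simp only [ε, x, Prod.mk.eta]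
    exact List.ofFn_getElem
  refine ⟨L.length, ε, (∑ l, ∑ l', d l l') + 1, ∑ l, x l 1, x, ⟨?_, ?_⟩, ?_⟩
  · intro l l' hl hε he
    have hne : x l ≠ x l' := by
      intro hxx
      have h1 := List.isChain_iff_getElem.1 hr l.1 (by have := l'.2; omega)
      have h2 : L[l.1 + 1]'(by have := l'.2; omega) = L[l'] := by
        simp [hl]
      rw [h2] at h1
      exact hε (h1 hxx)
    refine hd l l' hne (pre_eq_iff.1 he _ ?_)
    have h1 : d l l' ≤ ∑ l', d l l' :=
      Finset.single_le_sum (f := fun l' => d l l') (fun _ _ => Nat.zero_le _) (Finset.mem_univ l')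
    have h2 : ∑ l', d l l' ≤ ∑ l, ∑ l', d l l' :=
      Finset.single_le_sum (f := fun l => ∑ l', d l l') (fun _ _ => Nat.zero_le _)
        (Finset.mem_univ l)
    omega
  · intro l
    have h1 : x l 1 ≤ ∑ l, x l 1 :=
      Finset.single_le_sum (f := fun l => x l 1) (fun _ _ => Nat.zero_le _) (Finset.mem_univ l)
    omega
  · intro p
    rw [hw, ← phi_mk, psi_apply]
    simp [L, FreeGroup.mk_toWord]

theorem fsig : IsFsigma ((fun g : Equiv.Perm ℕ => (g : ℕ → ℕ)) ''
    ((Subgroup.closure (Set.range gN) : Subgroup (Equiv.Perm ℕ)) : Set (Equiv.Perm ℕ))) := by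
  obtain ⟨s, hs⟩ := exists_surjective_nat (Σ m : ℕ, (Fin m → Bool) × ℕ × ℕ)
  let pc : (Σ m : ℕ, (Fin m → Bool) × ℕ × ℕ) → Set (ℕ → ℕ) :=
    fun a => piece a.2.1 a.2.2.1 a.2.2.2
  refine ⟨fun n => pc (s n), fun n => piece_closed _ _ _, ?_⟩
  apply Set.Subset.antisymm
  · rintro _ ⟨h, hh, rfl⟩
    rw [closure_eq] at hh
    obtain ⟨w, rfl⟩ := hh
    obtain ⟨m, ε, N, j, hm⟩ := mem_piece w
    obtain ⟨n, hn⟩ := hs ⟨m, ε, N, j⟩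
    refine Set.mem_iUnion.2 ⟨n, ?_⟩
    show _ ∈ pc (s n)
    rw [hn]
    exact hm
  · exact Set.iUnion_subset fun n => piece_sub _ _ _

theorem F_closed : IsClosed ((fun g : Equiv.Perm ℕ => (g : ℕ → ℕ)) '' Set.range gN) := by
  have : ((fun g : Equiv.Perm ℕ => (g : ℕ → ℕ)) '' Set.range gN) =
      piece (fun _ : Fin 1 => true) 0 0 ∪ piece (fun _ : Fin 1 => true) 0 1 := by
    have hrun : ∀ (x : ℕ → ℕ) (p : T), run [(x, true)] p = phi (FreeGroup.of x) p := by
      intro x p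
      rw [← phi_mk]; rfl
    apply Set.Subset.antisymm
    · rintro _ ⟨_, ⟨x, rfl⟩, rfl⟩
      have key : ∀ j, x 1 ≠ j + 1 → (gN x : ℕ → ℕ) ∈ piece (fun _ : Fin 1 => true) 0 j := by
        intro j hj
        refine ⟨fun _ => x, ⟨fun l l' h => by omega, fun _ => hj⟩, fun p => ?_⟩
        have : wrd (fun _ : Fin 1 => true) (fun _ => x) = [(x, true)] := by simp [wrd]
        rw [this, hrun, gN, psi_apply]
        simp
      by_cases h : x 1 = 1
      · right; exact key 1 (by omega)
      · left; exact key 0 (by omega)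
    · have key : ∀ j, piece (fun _ : Fin 1 => true) 0 j ⊆
          ((fun g : Equiv.Perm ℕ => (g : ℕ → ℕ)) '' Set.range gN) := by
        rintro j φ ⟨x, _, hx⟩
        refine ⟨_, ⟨x 0, rfl⟩, ?_⟩
        funext k
        show gN (x 0) k = _
        have : wrd (fun _ : Fin 1 => true) x = [(x 0, true)] := by simp [wrd]
        rw [this] at hx
        rw [gN, psi_apply, ← hrun, ← hx]
        simp
      exact Set.union_subset (key 0) (key 1)
  rw [this]
  exact (piece_closed _ _ _).union (piece_closed _ _ _)

end
end MCG

theorem exists_closed_free_generating_set_of_Fsigma_mcg :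
    ∃ F : Set (Equiv.Perm ℕ),
      IsClosed ((fun g : Equiv.Perm ℕ => (g : ℕ → ℕ)) '' F) ∧
      FreelyGenerates F ∧
      IsMaximalCofinitary (Subgroup.closure F) ∧
      IsFsigma ((fun g : Equiv.Perm ℕ => (g : ℕ → ℕ)) ''
        ((Subgroup.closure F : Subgroup (Equiv.Perm ℕ)) : Set (Equiv.Perm ℕ))) :=
  ⟨Set.range MCG.gN, MCG.F_closed, MCG.free_gen, MCG.maxim, MCG.fsig⟩
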